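/- arXiv:2312.00205 — 3 statements merged into one kernel-verified Lean document; each statement's English description precedes it below -/
import Mathlib

section
/- Let I be a non-pathological Σ⁰₂ ideal on ω. Then the following are equivalent: (a) I is Egorov; (b) I is countably generated; (c) I is isomorphic to Fin, to Fin ⊕ P(ω), or to Fin ⊗ {∅}. -/
open MeasureTheory Set

/-- An ideal on a (countable) set `X`. -/
def IsIdeal {X : Type} (I : Set (Set X)) : Prop :=
  (∀ A B : Set X, A ∈ I → B ∈ I → A ∪ B ∈ I) ∧
  (∀ A B : Set X, A ⊆ B → B ∈ I → A ∈ I) ∧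
  (∀ A : Set X, A.Finite → A ∈ I) ∧
  (Set.univ : Set X) ∉ I

/-- `I`-pointwise convergence on `[0,1]` of a family of functions. -/
def IConvPtwise {X : Type} (I : Set (Set X)) (f : X → ℝ → ℝ) (g : ℝ → ℝ) : Prop :=
  ∀ t ∈ Icc (0:ℝ) 1, ∀ ε : ℝ, 0 < ε → {a : X | ε ≤ |f a t - g t|} ∈ I

/-- `I`-uniform convergence on `M` of a family of functions. -/
def IConvUnif {X : Type} (I : Set (Set X)) (f : X → ℝ → ℝ) (g : ℝ → ℝ) (M : Set ℝ) : Prop :=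
  ∀ ε : ℝ, 0 < ε → {a : X | ∃ t ∈ M, ε ≤ |f a t - g t|} ∈ I

/-- `I` is an Egorov ideal. -/
def IsEgorov {X : Type} (I : Set (Set X)) : Prop :=
  ∀ (f : X → ℝ → ℝ) (g : ℝ → ℝ),
    (∀ a : X, AEMeasurable (f a) (volume.restrict (Icc (0:ℝ) 1))) →
    AEMeasurable g (volume.restrict (Icc (0:ℝ) 1)) →
    IConvPtwise I f g →
    ∀ η : ℝ, 0 < η →
      ∃ M : Set ℝ, M ⊆ Icc (0:ℝ) 1 ∧ NullMeasurableSet M volume ∧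
        volume (Icc (0:ℝ) 1 \ M) < ENNReal.ofReal η ∧
        IConvUnif I f g M

def IsSubmeasure (φ : Set ℕ → ENNReal) : Prop :=
  φ ∅ = 0 ∧ (∀ n : ℕ, φ {n} < ⊤) ∧
  ∀ A B : Set ℕ, φ A ≤ φ (A ∪ B) ∧ φ (A ∪ B) ≤ φ A + φ B

def IsLscSubmeasure (φ : Set ℕ → ENNReal) : Prop :=
  ∀ A : Set ℕ, φ A = ⨆ n : ℕ, φ (A ∩ Iio n)

def IsNonpathological (φ : Set ℕ → ENNReal) : Prop :=
  ∀ A : Set ℕ, φ A = ⨆ (μ : Measure ℕ) (_ : ∀ B : Set ℕ, μ B ≤ φ B), μ A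

/-- `I` is a non-pathological Σ⁰₂ ideal: `I = Fin(φ)` for some non-pathological
lsc submeasure `φ` with `φ(ω) = ∞`. -/
def IsNonpathSigma2 (I : Set (Set ℕ)) : Prop :=
  ∃ φ : Set ℕ → ENNReal, IsSubmeasure φ ∧ IsLscSubmeasure φ ∧ IsNonpathological φ ∧
    φ Set.univ = ⊤ ∧ I = {A : Set ℕ | φ A < ⊤}

def IdealCountablyGenerated {X : Type} (I : Set (Set X)) : Prop :=
  ∃ B : Set (Set X), B.Countable ∧ B ⊆ I ∧
    ∀ A ∈ I, ∃ F : Set (Set X), F ⊆ B ∧ F.Finite ∧ A ⊆ ⋃₀ F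

def IdealIso {X Y : Type} (I : Set (Set X)) (J : Set (Set Y)) : Prop :=
  ∃ f : Y → X, Function.Bijective f ∧ ∀ A : Set X, (A ∈ I ↔ f ⁻¹' A ∈ J)

def RKle {X Y : Type} (I : Set (Set X)) (J : Set (Set Y)) : Prop :=
  ∃ f : Y → X, ∀ A : Set X, (A ∈ I ↔ f ⁻¹' A ∈ J)

def RBle {X Y : Type} (I : Set (Set X)) (J : Set (Set Y)) : Prop :=
  ∃ f : Y → X, (∀ x : X, (f ⁻¹' {x}).Finite) ∧ ∀ A : Set X, (A ∈ I ↔ f ⁻¹' A ∈ J)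

/-- The restriction `I↾A` of an ideal, as an ideal on the subtype `↥A`. -/
def restrictIdeal {X : Type} (I : Set (Set X)) (A : Set X) : Set (Set ↥A) :=
  {S : Set ↥A | (Subtype.val '' S) ∈ I}

def IsTall {X : Type} (I : Set (Set X)) : Prop :=
  ∀ A : Set X, A.Infinite → ∃ B ∈ I, B.Infinite ∧ B ⊆ A

/-- The ideal `Fin` of finite subsets of `ω`. -/
def FinIdeal : Set (Set ℕ) := {A : Set ℕ | A.Finite}

/-- The ideal `Fin ⊕ P(ω)` on `({0}×ω) ∪ ({1}×ω)` (modelled on `Bool × ℕ`,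
with `false` playing the role of `0`). -/
def FinOplusAll : Set (Set (Bool × ℕ)) := {M | {n : ℕ | (false, n) ∈ M}.Finite}

/-- The ideal `Fin ⊗ {∅}` on `ω²`. -/
def FinOtimesEmpty : Set (Set (ℕ × ℕ)) := {M | {n : ℕ | ∃ k : ℕ, (n, k) ∈ M}.Finite}


def pathState {σ : Type} (s0 : σ) (step : σ → ℕ → σ) (ω : ℕ → ℕ) : ℕ → σ
  | 0 => s0
  | (j+1) => step (pathState s0 step ω j) (ω (j+1))

lemma pathState_congr {σ : Type} (s0 : σ) (step : σ → ℕ → σ) (ω ω' : ℕ → ℕ) (n : ℕ)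
    (h : ∀ i ≤ n, ω i = ω' i) : pathState s0 step ω n = pathState s0 step ω' n := by
  induction n with
  | zero => rfl
  | succ n ih =>
    simp only [pathState]
    rw [ih (fun i hi => h i (by omega)), h (n+1) le_rfl]

def extHist (n : ℕ) (h : (i : Finset.Iic n) → ℕ) : ℕ → ℕ :=
  fun i => if hi : i ≤ n then h ⟨i, Finset.mem_Iic.2 hi⟩ else 0

lemma pathState_ext {σ : Type} (s0 : σ) (step : σ → ℕ → σ) (ω : ℕ → ℕ) (n : ℕ) :
    pathState s0 step (extHist n (Preorder.frestrictLe n ω)) n = pathState s0 step ω n := by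
  apply pathState_congr
  intro i hi
  simp [extHist, hi]

lemma measurableSet_pathState {σ : Type} (s0 : σ) (step : σ → ℕ → σ) (n : ℕ) (S : Set σ) :
    MeasurableSet {ω : ℕ → ℕ | pathState s0 step ω n ∈ S} := by
  have : {ω : ℕ → ℕ | pathState s0 step ω n ∈ S} =
      (Preorder.frestrictLe (π := fun _ => ℕ) n) ⁻¹'
        {h | pathState s0 step (extHist n h) n ∈ S} := by
    ext ω
    simp only [mem_ofPred_eq, mem_preimage, pathState_ext]
  rw [this]
  exact (Preorder.measurable_frestrictLe n) (Set.to_countable _).measurableSet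

lemma exists_path_measure {σ : Type} (s0 : σ) (step : σ → ℕ → σ)
    (m : ℕ → σ → Measure ℕ) (hm : ∀ j s, IsProbabilityMeasure (m j s)) :
    ∃ ν : Measure (ℕ → ℕ), IsProbabilityMeasure ν ∧
      ∀ (j : ℕ) (D : σ → Set ℕ) (c : ENNReal), (∀ s, m j s (D s) ≤ c) →
        ν {ω | ω (j+1) ∈ D (pathState s0 step ω j)} ≤ c := by
  classical
  let κ : (n : ℕ) → ProbabilityTheory.Kernel ((i : Finset.Iic n) → (fun _ : ℕ => ℕ) i) ℕ :=
    fun n => ⟨fun h => m n (pathState s0 step (extHist n h) n), measurable_of_countable _⟩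
  have hκ : ∀ n, ProbabilityTheory.IsMarkovKernel (κ n) := fun n => ⟨fun h => hm _ _⟩
  let ν : Measure (ℕ → ℕ) := ProbabilityTheory.Kernel.trajMeasure (X := fun _ => ℕ)
    (Measure.dirac (0:ℕ)) κ
  have hν : IsProbabilityMeasure ν := by
    show IsProbabilityMeasure (ProbabilityTheory.Kernel.trajMeasure (X := fun _ => ℕ)
      (Measure.dirac (0:ℕ)) κ)
    infer_instance
  refine ⟨ν, hν, ?_⟩
  intro j D c hD
  have key := ProbabilityTheory.Kernel.map_frestrictLe_trajMeasure_compProd_eq_map_trajMeasure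
    (X := fun _ => ℕ) (μ₀ := Measure.dirac (0:ℕ)) (κ := κ) (a := j)
  let D' : Set (((i : Finset.Iic j) → ℕ) × ℕ) :=
    {p | p.2 ∈ D (pathState s0 step (extHist j p.1) j)}
  have hD' : MeasurableSet D' := (Set.to_countable _).measurableSet
  have e : {ω : ℕ → ℕ | ω (j+1) ∈ D (pathState s0 step ω j)} =
      (fun x : ℕ → ℕ => (Preorder.frestrictLe (π := fun _ => ℕ) j x, x (j+1))) ⁻¹' D' := by
    ext ω
    simp only [mem_ofPred_eq, mem_preimage, D', pathState_ext]
  rw [e, ← Measure.map_apply (by fun_prop) hD']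
  change (Measure.map _ (ProbabilityTheory.Kernel.trajMeasure (X := fun _ => ℕ)
      (Measure.dirac (0:ℕ)) κ)) D' ≤ c
  rw [← key, Measure.compProd_apply hD']
  have : IsProbabilityMeasure (Measure.map (Preorder.frestrictLe (π := fun _ => ℕ) j) ν) :=
    Measure.isProbabilityMeasure_map (by fun_prop)
  calc _ ≤ ∫⁻ _ , c ∂(Measure.map (Preorder.frestrictLe (π := fun _ => ℕ) j) ν) :=
        lintegral_mono (fun h => hD _)
    _ = c := by simp

/-- transfer to `[0,1]` -/
lemma not_egorov_of_measure (I : Set (Set ℕ)) (ν : Measure (ℕ → ℕ)) [IsProbabilityMeasure ν]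
    (A : (ℕ → ℕ) → Set ℕ) (hA : ∀ ω, A ω ∈ I)
    (hmono : ∀ A B : Set ℕ, A ⊆ B → B ∈ I → A ∈ I)
    (hmeas : ∀ a, MeasurableSet {ω | a ∈ A ω})
    (hZ : ∀ Z ∈ I, ν {ω | A ω ⊆ Z} ≤ 1/2) : ¬ IsEgorov I := by
  classical
  intro hE
  obtain ⟨f, hf, hfν⟩ := ν.exists_measurable_map_eq
  let F : ℝ → (ℕ → ℕ) := fun t => f (projIcc 0 1 zero_le_one t)
  have hF : Measurable F := hf.comp continuous_projIcc.measurable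
  let u : ℕ → ℝ → ℝ := fun a t => if a ∈ A (F t) then 1 else 0
  have hu : ∀ a, Measurable (u a) := fun a =>
    Measurable.ite (hF (hmeas a)) measurable_const measurable_const
  obtain ⟨M, hM, -, hMv, hMu⟩ := hE u 0 (fun a => (hu a).aemeasurable) aemeasurable_const
    (by
      intro t ht ε hε
      refine hmono _ _ ?_ (hA (F t))
      intro a ha
      by_contra hc
      simp [u, hc] at ha
      linarith) (1/2) (by norm_num)
  have hZI := hMu 1 one_pos
  have h2 := hZ _ hZI
  set Z := {a : ℕ | ∃ t ∈ M, 1 ≤ |u a t - (0 : ℝ → ℝ) t|} with hZdef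
  have hWm : MeasurableSet {ω | A ω ⊆ Z} := by
    have : {ω | A ω ⊆ Z} = ⋂ a : (Zᶜ : Set ℕ), {ω | a.1 ∈ A ω}ᶜ := by
      ext ω
      simp only [mem_ofPred_eq, mem_iInter, mem_compl_iff, Subtype.forall]
      exact ⟨fun h a ha hh => ha (h hh), fun h a ha => by_contra fun hh => h a hh ha⟩
    rw [this]
    exact MeasurableSet.iInter fun a => (hmeas a).compl
  rw [← hfν, Measure.map_apply hf hWm] at h2
  have h3 : M ⊆ Subtype.val '' (f ⁻¹' {ω | A ω ⊆ Z}) := by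
    intro t ht
    refine ⟨⟨t, hM ht⟩, ?_, rfl⟩
    intro a ha
    refine ⟨t, ht, ?_⟩
    have : F t = f ⟨t, hM ht⟩ := by simp only [F]; rw [projIcc_of_mem _ (hM ht)]
    simp [u, this, ha]
  have h4 : volume M ≤ 1/2 := by
    refine (measure_mono h3).trans ?_
    refine le_trans (le_of_eq ?_) h2
    rw [← volume_image_subtype_coe measurableSet_Icc]
  have h5 : (1 : ENNReal) ≤ volume M + volume (Icc (0:ℝ) 1 \ M) := by
    have : volume (Icc (0:ℝ) 1) = 1 := by simp
    rw [← this]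
    refine (measure_mono ?_).trans (measure_union_le _ _)
    intro x hx
    by_cases h : x ∈ M
    · exact Or.inl h
    · exact Or.inr ⟨hx, h⟩
  have h6 : volume M + volume (Icc (0:ℝ) 1 \ M) < 1/2 + ENNReal.ofReal (1/2) :=
    ENNReal.add_lt_add_of_le_of_lt (ne_top_of_le_ne_top (by simp) h4) h4 hMv
  have h7 : (1/2 : ENNReal) + ENNReal.ofReal (1/2) = 1 := by
    rw [ENNReal.ofReal_div_of_pos (by norm_num)]
    simp [ENNReal.inv_two_add_inv_two]
  rw [h7] at h6
  exact absurd h5 (not_le.2 h6)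

lemma subm_mono {φ : Set ℕ → ENNReal} (h : IsSubmeasure φ) {A B : Set ℕ} (hAB : A ⊆ B) :
    φ A ≤ φ B := by
  have := (h.2.2 A B).1
  rwa [union_eq_self_of_subset_left hAB] at this

lemma subm_finite {φ : Set ℕ → ENNReal} (h : IsSubmeasure φ) {A : Set ℕ} (hA : A.Finite) :
    φ A < ⊤ := by
  induction A, hA using Set.Finite.induction_on with
  | empty => rw [h.1]; simp
  | @insert a s _ _ ih =>
    rw [insert_eq]
    exact ((h.2.2 _ _).2).trans_lt (ENNReal.add_lt_top.2 ⟨h.2.1 a, ih⟩)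

lemma subm_isIdeal {φ : Set ℕ → ENNReal} (h : IsSubmeasure φ) (htop : φ univ = ⊤) :
    IsIdeal {A : Set ℕ | φ A < ⊤} := by
  refine ⟨fun A B hA hB => ?_, fun A B hAB hB => ?_, fun A hA => subm_finite h hA, ?_⟩
  · exact ((h.2.2 _ _).2).trans_lt (ENNReal.add_lt_top.2 ⟨hA, hB⟩)
  · exact (subm_mono h hAB).trans_lt hB
  · intro hh
    have : φ univ < ⊤ := hh
    rw [htop] at this
    exact lt_irrefl _ this

/-- A family of sets is countably covered by `I`. -/
def CtblCov (I : Set (Set ℕ)) (E : Set (Set ℕ)) : Prop :=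
  ∃ B : Set (Set ℕ), B.Countable ∧ B ⊆ I ∧ ∀ A ∈ E, ∃ C ∈ B, A ⊆ C

/-- A finite set is good if its `k`-bounded supersets are not countably covered. -/
def GoodSet (φ : Set ℕ → ENNReal) (k : ℕ) (s : Finset ℕ) : Prop :=
  ¬ CtblCov {A : Set ℕ | φ A < ⊤} {A : Set ℕ | φ A ≤ k ∧ (s : Set ℕ) ⊆ A}

lemma exists_good {φ : Set ℕ → ENNReal}
    (hn : ¬ IdealCountablyGenerated {A : Set ℕ | φ A < ⊤}) : ∃ k, GoodSet φ k ∅ := by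
  by_contra hc
  push Not at hc
  unfold GoodSet at hc
  simp only [not_not] at hc
  choose B hBc hBI hB using hc
  apply hn
  refine ⟨⋃ k, B k, countable_iUnion hBc, iUnion_subset hBI, ?_⟩
  intro A hA
  obtain ⟨k, hk⟩ := ENNReal.exists_nat_gt (ne_of_lt hA)
  obtain ⟨C, hC, hAC⟩ := hB k A ⟨hk.le, by simp⟩
  exact ⟨{C}, by simpa using ⟨k, hC⟩, finite_singleton _, by simpa using hAC⟩

lemma good_le {φ : Set ℕ → ENNReal} (h : IsSubmeasure φ) {k : ℕ} {s : Finset ℕ}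
    (hs : GoodSet φ k s) : φ s ≤ k := by
  by_contra hc
  apply hs
  refine ⟨∅, countable_empty, empty_subset _, ?_⟩
  rintro A ⟨hA, hsA⟩
  exact absurd ((subm_mono h hsA).trans hA) hc

lemma good_ext {φ : Set ℕ → ENNReal} {k : ℕ} {s : Finset ℕ}
    (hs : GoodSet φ k s) : φ {a | GoodSet φ k (insert a s)} = ⊤ := by
  by_contra hV
  apply hs
  have : ∀ a : {a // ¬ GoodSet φ k (insert a s)}, CtblCov {A : Set ℕ | φ A < ⊤}
      {A : Set ℕ | φ A ≤ k ∧ ((insert a.1 s : Finset ℕ) : Set ℕ) ⊆ A} := by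
    rintro ⟨a, ha⟩
    exact not_not.1 ha
  choose B hBc hBI hB using this
  refine ⟨insert {a | GoodSet φ k (insert a s)} (⋃ a, B a), (countable_iUnion hBc).insert _,
    insert_subset (lt_top_iff_ne_top.2 hV) (iUnion_subset hBI), ?_⟩
  rintro A ⟨hA, hsA⟩
  by_cases hAV : A ⊆ {a | GoodSet φ k (insert a s)}
  · exact ⟨_, mem_insert _ _, hAV⟩
  · obtain ⟨a, haA, ha⟩ := not_subset.1 hAV
    obtain ⟨C, hC, hAC⟩ := hB ⟨a, ha⟩ A ⟨hA, by
      rw [Finset.coe_insert]; exact insert_subset haA hsA⟩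
    exact ⟨C, mem_insert_of_mem _ (mem_iUnion.2 ⟨_, hC⟩), hAC⟩

lemma exists_prob {φ : Set ℕ → ENNReal} (h : IsSubmeasure φ) (hl : IsLscSubmeasure φ)
    (hnp : IsNonpathological φ) (V : Set ℕ) (hV : φ V = ⊤) (j : ℕ) :
    ∃ m : Measure ℕ, IsProbabilityMeasure m ∧ ∀ Z : Set ℕ, φ Z ≤ j → m (Z ∪ Vᶜ) ≤ 1/2 := by
  rw [hl V] at hV
  have h1 : (2 * (j+1) : ENNReal) < ⨆ n : ℕ, φ (V ∩ Iio n) := by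
    rw [hV]; exact ENNReal.mul_lt_top (by simp) (by simp)
  obtain ⟨n, hn⟩ := lt_iSup_iff.1 h1
  set T := V ∩ Iio n with hT
  have hTf : φ T < ⊤ := subm_finite h ((finite_Iio n).subset inter_subset_right)
  have hn' := hn
  rw [hnp T] at hn'
  obtain ⟨μ, hμ⟩ := lt_iSup_iff.1 hn'
  obtain ⟨hμφ, hμT⟩ := lt_iSup_iff.1 hμ
  have hT0 : μ T ≠ 0 := (pos_of_gt hμT).ne'
  have hTtop : μ T ≠ ⊤ := ((hμφ T).trans_lt hTf).ne
  refine ⟨(μ T)⁻¹ • μ.restrict T, ⟨?_⟩, ?_⟩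
  · simp [ENNReal.inv_mul_cancel hT0 hTtop]
  · intro Z hZ
    have hm : MeasurableSet (Z ∪ Vᶜ) := MeasurableSet.of_discrete
    rw [Measure.smul_apply, Measure.restrict_apply hm, smul_eq_mul]
    have h2 : μ ((Z ∪ Vᶜ) ∩ T) ≤ j := by
      refine (measure_mono ?_).trans ((hμφ Z).trans hZ)
      rintro x ⟨hx | hx, hxT⟩
      · exact hx
      · exact absurd hxT.1 hx
    have h3 : (j : ENNReal) ≤ μ T * (1/2) := by
      have : (j : ENNReal) = (2 * j) * (1/2) := by
        rw [mul_comm 2, mul_assoc]; simp [ENNReal.mul_inv_cancel]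
      rw [this]
      gcongr
      refine le_trans ?_ hμT.le
      gcongr
      exact le_self_add
    calc (μ T)⁻¹ * μ ((Z ∪ Vᶜ) ∩ T) ≤ (μ T)⁻¹ * (μ T * (1/2)) := by gcongr; exact h2.trans h3
      _ = 1/2 := by rw [← mul_assoc, ENNReal.inv_mul_cancel hT0 hTtop, one_mul]

lemma pathState_mono_sub {p : Finset ℕ → Prop} (s0 : {s // p s})
    (step : {s // p s} → ℕ → {s // p s}) (hst : ∀ s a, s.1 ⊆ (step s a).1) (ω : ℕ → ℕ) :
    Monotone (fun j => (pathState s0 step ω j).1) :=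
  monotone_nat_of_le_succ fun j => hst _ _

lemma ctblGen_of_egorov {φ : Set ℕ → ENNReal} (h : IsSubmeasure φ) (hl : IsLscSubmeasure φ)
    (hnp : IsNonpathological φ) (hE : IsEgorov {A : Set ℕ | φ A < ⊤}) :
    IdealCountablyGenerated {A : Set ℕ | φ A < ⊤} := by
  classical
  by_contra hn
  obtain ⟨k, hk⟩ := exists_good hn
  choose m hmp hm using fun (j : ℕ) (s : {s // GoodSet φ k s}) =>
    exists_prob h hl hnp _ (good_ext s.2) j
  let s0 : {s // GoodSet φ k s} := ⟨∅, hk⟩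
  let step : {s // GoodSet φ k s} → ℕ → {s // GoodSet φ k s} := fun s a =>
    if ha : GoodSet φ k (insert a s.1) then ⟨insert a s.1, ha⟩ else s
  have hstep : ∀ s a, s.1 ⊆ (step s a).1 := by
    intro s a
    by_cases ha : GoodSet φ k (insert a s.1)
    · simp [step, ha]
    · simp [step, ha]
  obtain ⟨ν, hν, hνc⟩ := exists_path_measure s0 step m hmp
  refine not_egorov_of_measure _ ν (fun ω => ⋃ j, ((pathState s0 step ω j).1 : Set ℕ))
    ?_ ?_ ?_ ?_ hE
  · intro ω
    have hmn := pathState_mono_sub s0 step hstep ω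
    refine lt_of_le_of_lt (b := (k : ENNReal)) ?_ (by simp)
    rw [hl]
    refine iSup_le fun n => ?_
    have hfin : ((⋃ j, ((pathState s0 step ω j).1 : Set ℕ)) ∩ Iio n).Finite :=
      (finite_Iio n).subset inter_subset_right
    have : ∃ j, (⋃ j, ((pathState s0 step ω j).1 : Set ℕ)) ∩ Iio n ⊆ (pathState s0 step ω j).1 := by
      obtain ⟨J, hJ, hJs⟩ := finite_subset_iUnion hfin inter_subset_left
      obtain ⟨N, hN⟩ := hJ.bddAbove
      refine ⟨N, hJs.trans (iUnion₂_subset fun i hi => ?_)⟩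
      exact Finset.coe_subset.2 (hmn (hN hi))
    obtain ⟨j, hj⟩ := this
    exact (subm_mono h hj).trans (good_le h (pathState s0 step ω j).2)
  · intro A B hAB hB
    exact (subm_mono h hAB).trans_lt hB
  · intro a
    have : {ω | a ∈ ⋃ j, ((pathState s0 step ω j).1 : Set ℕ)} =
        ⋃ j, {ω | pathState s0 step ω j ∈ {s : {s // GoodSet φ k s} | a ∈ s.1}} := by
      ext ω; simp
    rw [this]
    exact MeasurableSet.iUnion fun j => measurableSet_pathState _ _ _ _
  · intro Z hZ
    obtain ⟨j, hj⟩ := ENNReal.exists_nat_gt (ne_of_lt hZ)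
    refine le_trans (measure_mono ?_) (hνc j
      (fun s => Z ∪ {a | GoodSet φ k (insert a s.1)}ᶜ) (1/2) (fun s => hm j s Z hj.le))
    intro ω hω
    by_cases hg : GoodSet φ k (insert (ω (j+1)) (pathState s0 step ω j).1)
    · left
      apply hω
      refine mem_iUnion.2 ⟨j+1, ?_⟩
      simp [pathState, step, hg]
    · right
      exact hg

lemma chain_of_ctblGen {I : Set (Set ℕ)} (hI : IsIdeal I) (h : IdealCountablyGenerated I) :
    ∃ C : ℕ → Set ℕ, Monotone C ∧ ∀ A, A ∈ I ↔ ∃ n, A ⊆ C n := by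
  classical
  obtain ⟨B, hBc, hBI, hB⟩ := h
  have hc : (insert ∅ B).Countable := hBc.insert _
  obtain ⟨b, hb⟩ := hc.exists_eq_range (insert_nonempty _ _)
  have hbI : ∀ n, b n ∈ I := by
    intro n
    have : b n ∈ insert ∅ B := by rw [hb]; exact mem_range_self n
    rcases this with h0 | h0
    · rw [h0]; exact hI.2.2.1 _ finite_empty
    · exact hBI h0
  refine ⟨fun n => ⋃ i ∈ Finset.range n, b i, ?_, ?_⟩
  · intro m n hmn
    exact biUnion_subset_biUnion_left fun i hi => by
      have hi' := Finset.mem_range.1 hi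
      exact Finset.mem_range.2 (by omega)
  · intro A
    constructor
    · intro hA
      obtain ⟨F, hFB, hF, hAF⟩ := hB A hA
      have : ∀ G : Set (Set ℕ), G.Finite → G ⊆ B → ∃ n, ⋃₀ G ⊆ ⋃ i ∈ Finset.range n, b i := by
        intro G hG hGB
        have hx : ∀ g ∈ G, ∃ i, b i = g := by
          intro g hg
          have : g ∈ insert ∅ B := mem_insert_of_mem _ (hGB hg)
          rw [hb] at this
          exact this
        choose! i hi using hx
        obtain ⟨N, hN⟩ := (hG.image i).bddAbove
        refine ⟨N+1, ?_⟩
        rintro x ⟨g, hg, hxg⟩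
        have h1 : i g ≤ N := hN (mem_image_of_mem _ hg)
        refine mem_biUnion (x := i g) (Finset.mem_coe.2 (Finset.mem_range.2 (by omega))) ?_
        rw [hi g hg]; exact hxg
      obtain ⟨n, hn⟩ := this F hF hFB
      exact ⟨n, hAF.trans hn⟩
    · rintro ⟨n, hn⟩
      refine hI.2.1 _ _ hn ?_
      clear hn
      induction n with
      | zero => simpa using hI.2.2.1 _ finite_empty
      | succ n ih =>
        show (⋃ i ∈ Finset.range (n+1), b i) ∈ I
        rw [Finset.range_add_one, Finset.set_biUnion_insert]
        exact hI.1 _ _ (hbI n) ih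

lemma egorov_of_chain {I : Set (Set ℕ)} (C : ℕ → Set ℕ) (hC : Monotone C)
    (hIC : ∀ A, A ∈ I ↔ ∃ n, A ⊆ C n) : IsEgorov I := by
  intro f g hf hg hfg η hη
  let E : ℕ → ℕ → Set ℝ := fun k n =>
    Icc (0:ℝ) 1 ∩ ⋂ a : ((C n)ᶜ : Set ℕ), {t | |f a.1 t - g t| < 1/((k:ℝ)+1)}
  have hE0 : ∀ k n, NullMeasurableSet (E k n) (volume.restrict (Icc (0:ℝ) 1)) := by
    intro k n
    refine measurableSet_Icc.nullMeasurableSet.inter (NullMeasurableSet.iInter fun a => ?_)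
    exact nullMeasurableSet_lt (((hf a.1).sub hg).abs) aemeasurable_const
  have hE : ∀ k n, NullMeasurableSet (E k n) volume := by
    intro k n
    have := (hE0 k n)
    rw [nullMeasurableSet_restrict measurableSet_Icc.nullMeasurableSet] at this
    rwa [inter_eq_self_of_subset_left inter_subset_left] at this
  have hanti : ∀ k, Antitone (fun n => Icc (0:ℝ) 1 \ E k n) := by
    intro k n n' hnn t ht
    refine ⟨ht.1, fun h => ht.2 ⟨ht.1, ?_⟩⟩
    have h2 := h.2
    rw [mem_iInter] at h2 ⊢
    rintro ⟨a, ha⟩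
    exact h2 ⟨a, fun hh => ha (hC hnn hh)⟩
  have hinter : ∀ k, ⋂ n, (Icc (0:ℝ) 1 \ E k n) = ∅ := by
    intro k
    rw [eq_empty_iff_forall_notMem]
    intro t ht
    rw [mem_iInter] at ht
    have ht0 : t ∈ Icc (0:ℝ) 1 := (ht 0).1
    obtain ⟨n, hn⟩ := (hIC _).1 (hfg t ht0 (1/((k:ℝ)+1)) (by positivity))
    refine (ht n).2 ⟨ht0, mem_iInter.2 ?_⟩
    rintro ⟨a, ha⟩
    by_contra hc
    have hc' : ¬ |f a t - g t| < 1/((k:ℝ)+1) := hc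
    refine ha (hn ?_)
    show 1/((k:ℝ)+1) ≤ |f a t - g t|
    exact not_lt.1 hc'
  have hex : ∀ k : ℕ, ∃ n, volume (Icc (0:ℝ) 1 \ E k n) < ENNReal.ofReal (η/2/2/2^k) := by
    intro k
    have hpos : (0:ENNReal) < ENNReal.ofReal (η/2/2/2^k) := by
      rw [ENNReal.ofReal_pos]; positivity
    have ht := tendsto_measure_iInter_atTop (μ := volume)
      (fun n => (measurableSet_Icc.nullMeasurableSet.diff (hE k n))) (hanti k)
      ⟨0, ne_top_of_le_ne_top (by simp) (measure_mono (sdiff_subset : Icc (0:ℝ) 1 \ E k 0 ⊆ Icc 0 1))⟩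
    rw [hinter k, measure_empty] at ht
    exact (ht.eventually (gt_mem_nhds hpos)).exists
  choose n hn using hex
  refine ⟨⋂ k, E k (n k), fun t ht => (mem_iInter.1 ht 0).1,
    NullMeasurableSet.iInter fun k => hE k _, ?_, ?_⟩
  · rw [sdiff_iInter]
    calc volume (⋃ k, Icc (0:ℝ) 1 \ E k (n k)) ≤ ∑' k, volume (Icc (0:ℝ) 1 \ E k (n k)) :=
          measure_iUnion_le _
      _ ≤ ∑' k : ℕ, ENNReal.ofReal (η/2/2/2^k) := ENNReal.tsum_le_tsum fun k => (hn k).le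
      _ = ENNReal.ofReal (η/2) := by
        rw [← ENNReal.ofReal_tsum_of_nonneg (fun k => by positivity) (summable_geometric_two' (η/2)),
          tsum_geometric_two']
      _ < ENNReal.ofReal η := by
        rw [ENNReal.ofReal_lt_ofReal_iff hη]; linarith
  · intro ε hε
    obtain ⟨k, hk⟩ := exists_nat_one_div_lt hε
    refine (hIC _).2 ⟨n k, ?_⟩
    rintro a ⟨t, ht, hat⟩
    by_contra hc
    have := mem_iInter.1 (mem_iInter.1 ht k).2 ⟨a, hc⟩
    have h2 : |f a t - g t| < 1/((k:ℝ)+1) := this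
    linarith

lemma exists_bij_fiber (S : Set ℕ) (hS : S.Infinite) :
    ∃ e : ℕ → ℕ, Function.Injective e ∧ range e = S :=
  ⟨Nat.nth (· ∈ S), Nat.nth_injective hS, Nat.range_nth_of_infinite hS⟩

lemma iso_of_chain {I : Set (Set ℕ)} (hI : IsIdeal I) (C : ℕ → Set ℕ) (hC : Monotone C)
    (hIC : ∀ A, A ∈ I ↔ ∃ n, A ⊆ C n) :
    IdealIso I FinIdeal ∨ IdealIso I FinOplusAll ∨ IdealIso I FinOtimesEmpty := by
  classical
  have hCI : ∀ n, C n ∈ I := fun n => (hIC _).2 ⟨n, le_rfl⟩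
  by_cases h1 : ∀ n, (C n).Finite
  · left
    refine ⟨id, Function.bijective_id, fun A => ?_⟩
    constructor
    · intro hA
      obtain ⟨n, hn⟩ := (hIC A).1 hA
      exact (h1 n).subset hn
    · intro hA
      exact hI.2.2.1 _ hA
  push Not at h1
  obtain ⟨n0, hn0⟩ := h1
  right
  by_cases h2 : ∃ n, (C n).Infinite ∧ ∀ m, (C m \ C n).Finite
  · left
    obtain ⟨n, hinf, hfin⟩ := h2
    have hco : ((C n)ᶜ).Infinite := by
      intro hf
      apply hI.2.2.2
      rw [← union_compl_self (C n)]
      exact hI.1 _ _ (hCI n) (hI.2.2.1 _ hf)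
    obtain ⟨e, he, hre⟩ := exists_bij_fiber _ hinf
    obtain ⟨dd, he', hre'⟩ := exists_bij_fiber _ hco
    have hm : ∀ k, e k ∈ C n := fun k => hre ▸ mem_range_self k
    have hm' : ∀ k, dd k ∉ C n := fun k => by
      have : dd k ∈ (C n)ᶜ := hre' ▸ mem_range_self k
      exact this
    refine ⟨fun p => if p.1 then e p.2 else dd p.2, ⟨?_, ?_⟩, ?_⟩
    · rintro ⟨b, k⟩ ⟨b', k'⟩ h
      cases b <;> cases b' <;> simp at h
      · rw [he' h]
      · exact absurd (hm k') (h ▸ hm' k)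
      · exact absurd (hm k) (h ▸ hm' k')
      · rw [he h]
    · intro x
      by_cases hx : x ∈ C n
      · rw [← hre] at hx
        obtain ⟨k, hk⟩ := hx
        exact ⟨(true, k), by simpa using hk⟩
      · have hx : x ∈ (C n)ᶜ := hx
        rw [← hre'] at hx
        obtain ⟨k, hk⟩ := hx
        exact ⟨(false, k), by simpa using hk⟩
    · intro A
      have e1 : (fun p : Bool × ℕ => if p.1 then e p.2 else dd p.2) ⁻¹' A ∈ FinOplusAll ↔
          (dd ⁻¹' A).Finite := by
        simp [FinOplusAll]; rfl
      rw [e1]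
      constructor
      · intro hA
        obtain ⟨m, hm2⟩ := (hIC A).1 hA
        refine Set.Finite.subset ((hfin m).preimage he'.injOn) ?_
        intro k hk
        exact ⟨hm2 hk, hm' k⟩
      · intro hA
        refine hI.2.1 _ (C n ∪ dd '' (dd ⁻¹' A)) ?_ (hI.1 _ _ (hCI n) (hI.2.2.1 _ (hA.image _)))
        intro x hx
        by_cases hxc : x ∈ C n
        · exact Or.inl hxc
        · have hxc : x ∈ (C n)ᶜ := hxc
          rw [← hre'] at hxc
          obtain ⟨k, rfl⟩ := hxc
          exact Or.inr ⟨k, hx, rfl⟩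
  · right
    push Not at h2
    have h3 : ∀ n : {n // (C n).Infinite}, ∃ m : {n // (C n).Infinite},
        n.1 < m.1 ∧ (C m.1 \ C n.1).Infinite := by
      rintro ⟨n, hn⟩
      obtain ⟨m, hm⟩ := h2 n hn
      have hnm : n < m := by
        by_contra hc
        apply hm
        rw [sdiff_eq_empty.2 (hC (not_lt.1 hc))]
        exact finite_empty
      exact ⟨⟨m, hn.mono (hC hnm.le)⟩, hnm, hm⟩
    choose nx hnx1 hnx2 using h3
    let q : ℕ → {n // (C n).Infinite} := fun i => nx^[i] ⟨n0, hn0⟩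
    have hq : ∀ i, q (i+1) = nx (q i) := fun i => Function.iterate_succ_apply' _ _ _
    let g : ℕ → ℕ := fun i => (q i).1
    have hg : StrictMono g := strictMono_nat_of_lt_succ fun i => by
      show (q i).1 < (q (i+1)).1
      rw [hq]; exact hnx1 _
    have hCg : Monotone (fun i => C (g i)) := hC.comp hg.monotone
    have hex : ∀ x, ∃ i, x ∈ C (g i) := by
      intro x
      obtain ⟨n, hn⟩ := (hIC {x}).1 (hI.2.2.1 _ (finite_singleton x))
      exact ⟨n, hC (hg.id_le n) (hn rfl)⟩
    let r : ℕ → ℕ := fun x => Nat.find (hex x)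
    have hr : ∀ x i, r x ≤ i ↔ x ∈ C (g i) := by
      intro x i
      constructor
      · intro h; exact hCg h (Nat.find_spec (hex x))
      · intro h; exact Nat.find_min' _ h
    have hfib : ∀ i, (r ⁻¹' {i}).Infinite := by
      intro i
      cases i with
      | zero =>
        refine hn0.mono ?_
        intro x hx
        exact Nat.le_zero.1 ((hr x 0).2 hx)
      | succ i =>
        refine (hnx2 (q i)).mono ?_
        rw [← hq]
        rintro x ⟨hx1, hx2⟩
        have a1 := (hr x (i+1)).2 hx1
        have a2 : ¬ r x ≤ i := fun h => hx2 ((hr x i).1 h)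
        show r x = i + 1
        omega
    choose e he hre using fun i => exists_bij_fiber _ (hfib i)
    have hr' : ∀ i k, r (e i k) = i := by
      intro i k
      have : e i k ∈ r ⁻¹' {i} := hre i ▸ mem_range_self k
      exact this
    have hsurj : ∀ x, ∃ k, e (r x) k = x := by
      intro x
      have : x ∈ r ⁻¹' {r x} := rfl
      rw [← hre] at this
      exact this
    refine ⟨fun p => e p.1 p.2, ⟨?_, ?_⟩, ?_⟩
    · rintro ⟨i, k⟩ ⟨i', k'⟩ h
      have h : e i k = e i' k' := h
      have hi : i = i' := by rw [← hr' i k, h, hr']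
      subst hi
      rw [he i h]
    · intro x
      obtain ⟨k, hk⟩ := hsurj x
      exact ⟨(r x, k), hk⟩
    · intro A
      constructor
      · intro hA
        obtain ⟨n, hn⟩ := (hIC A).1 hA
        refine (finite_Iic n).subset ?_
        rintro i ⟨k, hk⟩
        have := (hr (e i k) n).2 (hC (hg.id_le n) (hn hk))
        rwa [hr'] at this
      · intro hA
        obtain ⟨N, hN⟩ := Set.Finite.bddAbove hA
        refine (hIC A).2 ⟨g N, ?_⟩
        intro x hx
        rw [← hr]
        obtain ⟨k, hk⟩ := hsurj x
        refine hN ⟨k, ?_⟩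
        show e (r x) k ∈ A
        rwa [hk]

lemma ctblGen_of_iso {X Y : Type} {I : Set (Set X)} {J : Set (Set Y)} (h : IdealIso I J)
    (D : ℕ → Set Y) (hD : ∀ n, D n ∈ J) (hJ : ∀ A ∈ J, ∃ n, A ⊆ D n) :
    IdealCountablyGenerated I := by
  obtain ⟨f, hf, hfI⟩ := h
  refine ⟨range fun n => f '' D n, countable_range _, ?_, ?_⟩
  · rintro _ ⟨n, rfl⟩
    rw [hfI, preimage_image_eq _ hf.1]
    exact hD n
  · intro A hA
    obtain ⟨n, hn⟩ := hJ _ ((hfI A).1 hA)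
    refine ⟨{f '' D n}, by simp, finite_singleton _, ?_⟩
    rw [sUnion_singleton, ← image_preimage_eq A hf.2]
    exact image_mono hn

lemma ctblGen_of_iso3 {I : Set (Set ℕ)}
    (h : IdealIso I FinIdeal ∨ IdealIso I FinOplusAll ∨ IdealIso I FinOtimesEmpty) :
    IdealCountablyGenerated I := by
  rcases h with h | h | h
  · refine ctblGen_of_iso h (fun n => Iic n) (fun n => finite_Iic n) ?_
    intro A hA
    obtain ⟨N, hN⟩ := Set.Finite.bddAbove hA
    exact ⟨N, hN⟩
  · refine ctblGen_of_iso h (fun n => {p | p.1 = false → p.2 ≤ n}) (fun n => ?_) ?_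
    · refine (finite_Iic n).subset ?_
      intro k hk
      exact hk rfl
    · intro A hA
      obtain ⟨N, hN⟩ := Set.Finite.bddAbove hA
      refine ⟨N, ?_⟩
      rintro ⟨b, k⟩ hk hb
      have hb : b = false := hb
      subst hb
      exact hN hk
  · refine ctblGen_of_iso h (fun n => {p | p.1 ≤ n}) (fun n => ?_) ?_
    · refine (finite_Iic n).subset ?_
      rintro i ⟨k, hk⟩
      exact hk
    · intro A hA
      obtain ⟨N, hN⟩ := Set.Finite.bddAbove hA
      refine ⟨N, ?_⟩
      rintro ⟨i, k⟩ hk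
      exact hN ⟨k, hk⟩

/-- For a non-pathological Σ⁰₂ ideal `I` on `ω`, the following are equivalent:
(a) `I` is Egorov; (b) `I` is countably generated; (c) `I` is isomorphic to
`Fin`, to `Fin ⊕ P(ω)`, or to `Fin ⊗ {∅}`. -/
theorem egorov_nonpath_sigma2_tfae (I : Set (Set ℕ)) (hI : IsNonpathSigma2 I) :
    (IsEgorov I ↔ IdealCountablyGenerated I) ∧
    (IdealCountablyGenerated I ↔
      (IdealIso I FinIdeal ∨ IdealIso I FinOplusAll ∨ IdealIso I FinOtimesEmpty)) := by
  obtain ⟨φ, h, hl, hnp, htop, rfl⟩ := hI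
  have hId := subm_isIdeal h htop
  refine ⟨⟨ctblGen_of_egorov h hl hnp, fun hc => ?_⟩, ⟨fun hc => ?_, ctblGen_of_iso3⟩⟩
  · obtain ⟨C, hC, hIC⟩ := chain_of_ctblGen hId hc
    exact egorov_of_chain C hC hIC
  · obtain ⟨C, hC, hIC⟩ := chain_of_ctblGen hId hc
    exact iso_of_chain hId C hC hIC
end

section
/- Every tall non-pathological Σ⁰₂ ideal on ω is not Egorov. -/
open MeasureTheory Set

namespace EgorovAux

open ProbabilityTheory

theorem mono {φ : Set ℕ → ENNReal} (h : IsSubmeasure φ) {A B : Set ℕ} (hAB : A ⊆ B) :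
    φ A ≤ φ B := by
  have := (h.2.2 A B).1
  rwa [union_eq_self_of_subset_left hAB] at this

theorem union_lt {φ : Set ℕ → ENNReal} (h : IsSubmeasure φ) {A B : Set ℕ} (hA : φ A < ⊤)
    (hB : φ B < ⊤) : φ (A ∪ B) < ⊤ :=
  lt_of_le_of_lt (h.2.2 A B).2 (ENNReal.add_lt_top.2 ⟨hA, hB⟩)

theorem finite_lt {φ : Set ℕ → ENNReal} (h : IsSubmeasure φ) {A : Set ℕ} (hA : A.Finite) :
    φ A < ⊤ := by
  induction A, hA using Set.Finite.induction_on with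
  | empty => simp [h.1]
  | insert _ _ ih => exact union_lt h (h.2.1 _) ih

theorem almost_disjoint {φ : Set ℕ → ENNReal} (h : IsSubmeasure φ) (htop : φ univ = ⊤)
    (Y : ℕ → Set ℕ) (hY : ∀ i, φ (Y i) < ⊤) :
    ∃ B : Set ℕ, B.Infinite ∧ ∀ i, (B ∩ Y i).Finite := by
  have hU : ∀ k, φ (⋃ i ∈ Iic k, Y i) < ⊤ := by
    intro k
    induction k with
    | zero => simpa using hY 0
    | succ k ih =>
      refine lt_of_le_of_lt (mono h ?_) (union_lt h ih (hY (k+1)))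
      intro n hn
      simp only [mem_iUnion, mem_Iic, mem_union] at hn ⊢
      obtain ⟨i, hi, hn⟩ := hn
      rcases Nat.lt_or_ge k i with hk | hk
      · right
        have : i = k + 1 := by omega
        rwa [← this]
      · exact Or.inl ⟨i, hk, hn⟩
  have hb : ∀ k, ∃ b, k ≤ b ∧ ∀ i ≤ k, b ∉ Y i := by
    intro k
    by_contra! hc
    have : φ univ < ⊤ := by
      refine lt_of_le_of_lt (mono h ?_) (union_lt h (hU k) (finite_lt h (finite_Iio k)))
      intro n _
      rcases Nat.lt_or_ge n k with hk | hk
      · exact Or.inr hk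
      · obtain ⟨i, hi, hn⟩ := hc n hk
        left
        simp only [mem_iUnion, mem_Iic]
        exact ⟨i, hi, hn⟩
    exact this.ne htop
  choose b hb1 hb2 using hb
  refine ⟨range b, ?_, ?_⟩
  · intro hfin
    obtain ⟨m, hm⟩ := hfin.bddAbove
    have := hm (mem_range_self (m+1))
    have := hb1 (m+1)
    omega
  · intro i
    refine ((finite_Iio i).image b).subset ?_
    rintro _ ⟨⟨k, rfl⟩, hk⟩
    refine ⟨k, ?_, rfl⟩
    by_contra hc
    exact hb2 k i (by simpa using hc) hk

/-- Positions in the closed game with bound `C` that are lost for the second player. -/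
inductive Bad (φ : Set ℕ → ENNReal) (C : ℕ) : Finset ℕ → Prop
  | big (s : Finset ℕ) (h : (C : ENNReal) < φ (s : Set ℕ)) : Bad φ C s
  | step (s : Finset ℕ) (Y : Set ℕ) (hY : φ Y < ⊤) (h : ∀ n, n ∉ Y → Bad φ C (insert n s)) :
      Bad φ C s

theorem bad_family {φ : Set ℕ → ENNReal} (h : IsSubmeasure φ) {C : ℕ} {s : Finset ℕ}
    (hs : Bad φ C s) : ∃ F : Set (Set ℕ), F.Countable ∧ (∀ Y ∈ F, φ Y < ⊤) ∧
      ∀ D : Set ℕ, D.Infinite → φ D ≤ C → (∀ Y ∈ F, (D ∩ Y).Finite) → ¬ (s : Set ℕ) ⊆ D := by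
  induction hs with
  | big s hs =>
    exact ⟨∅, countable_empty, by simp, fun D _ hD _ hsD =>
      absurd (hs.trans_le (mono h hsD)) (not_lt.2 hD)⟩
  | step s Y hY hn ih =>
    choose! F hF1 hF2 hF3 using ih
    refine ⟨insert Y (⋃ n ∈ Yᶜ, F n), ?_, ?_, ?_⟩
    · exact ((to_countable Yᶜ).biUnion fun n hn => hF1 n hn).insert Y
    · intro Z hZ
      rcases hZ with rfl | hZ
      · exact hY
      · simp only [mem_iUnion] at hZ
        obtain ⟨n, hn, hZ⟩ := hZ
        exact hF2 n hn Z hZ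
    · intro D hinf hD hfin hsD
      obtain ⟨n, hnD, hnot⟩ := (hinf.sdiff (hfin Y (mem_insert _ _))).nonempty
      have hnY : n ∉ Y := fun hy => hnot ⟨hnD, hy⟩
      refine hF3 n hnY D hinf hD (fun Z hZ => hfin Z (Or.inr ?_)) ?_
      · simp only [mem_iUnion]
        exact ⟨n, hnY, hZ⟩
      · rw [Finset.coe_insert]
        exact insert_subset hnD hsD

theorem exists_good {φ : Set ℕ → ENNReal} (h : IsSubmeasure φ) (htop : φ univ = ⊤)
    (htall : IsTall {A : Set ℕ | φ A < ⊤}) : ∃ C, ¬ Bad φ C ∅ := by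
  by_contra! hc
  choose F hF1 hF2 hF3 using fun C => bad_family h (hc C)
  have hcount : (insert ∅ (⋃ C, F C)).Countable := (countable_iUnion hF1).insert ∅
  obtain ⟨Y, hY⟩ := hcount.exists_eq_range ⟨∅, mem_insert _ _⟩
  obtain ⟨B, hB, hBY⟩ := almost_disjoint h htop Y (by
    intro i
    have hi : Y i ∈ insert ∅ (⋃ C, F C) := by rw [hY]; exact mem_range_self i
    rcases hi with hi | hi
    · rw [hi, h.1]; simp
    · obtain ⟨C, hi⟩ := mem_iUnion.1 hi
      exact hF2 C _ hi)
  obtain ⟨D, hD, hDinf, hDB⟩ := htall B hB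
  obtain ⟨C, hC⟩ := ENNReal.exists_nat_gt (ne_of_lt hD)
  refine hF3 C D hDinf hC.le (fun Z hZ => ?_) (by simp)
  have hZ' : Z ∈ insert ∅ (⋃ C, F C) := Or.inr (mem_iUnion.2 ⟨C, hZ⟩)
  rw [hY] at hZ'
  obtain ⟨i, rfl⟩ := hZ'
  exact (hBY i).subset (inter_subset_inter_left _ hDB)

theorem good_le {φ : Set ℕ → ENNReal} {C : ℕ} {s : Finset ℕ} (hs : ¬ Bad φ C s) :
    φ (s : Set ℕ) ≤ C := by
  by_contra hc
  exact hs (Bad.big s (not_le.1 hc))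

theorem good_top {φ : Set ℕ → ENNReal} {C : ℕ} {s : Finset ℕ} (hs : ¬ Bad φ C s) :
    φ {n | ¬ Bad φ C (insert n s)} = ⊤ := by
  by_contra hc
  exact hs (Bad.step s _ (lt_top_iff_ne_top.2 hc) (fun n hn => by simpa using hn))

theorem exists_prob {φ : Set ℕ → ENNReal} (h : IsSubmeasure φ) (hl : IsLscSubmeasure φ)
    (hn : IsNonpathological φ) {P : Set ℕ} (hP : φ P = ⊤) (N : ℕ) :
    ∃ p : Measure ℕ, IsProbabilityMeasure p ∧ p Pᶜ = 0 ∧ ∀ H, N * p H ≤ φ H := by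
  have h1 : (N : ENNReal) < ⨆ n : ℕ, φ (P ∩ Iio n) := by
    rw [← hl P, hP]; exact ENNReal.natCast_lt_top N
  obtain ⟨n, hN⟩ := lt_iSup_iff.1 h1
  rw [hn] at hN
  obtain ⟨μ, hN⟩ := lt_iSup_iff.1 hN
  obtain ⟨hμ, hN⟩ := lt_iSup_iff.1 hN
  set F := P ∩ Iio n with hF
  have hFtop : μ F ≠ ⊤ :=
    ((hμ F).trans_lt (finite_lt h ((finite_Iio n).subset inter_subset_right))).ne
  have hF0 : μ F ≠ 0 := (lt_of_le_of_lt zero_le hN).ne'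
  have hm : MeasurableSet F := MeasurableSet.of_discrete
  refine ⟨ProbabilityTheory.cond μ F, cond_isProbabilityMeasure_of_finite hF0 hFtop, ?_, ?_⟩
  · rw [cond_apply hm]
    have : F ∩ Pᶜ = ∅ := by
      ext x; simp [hF]; tauto
    simp [this]
  · intro H
    rw [cond_apply hm, ← mul_assoc]
    calc (N : ENNReal) * (μ F)⁻¹ * μ (F ∩ H) ≤ 1 * μ (F ∩ H) := by
          gcongr
          rw [← ENNReal.mul_inv_cancel hF0 hFtop]
          gcongr
      _ ≤ φ H := by
          rw [one_mul]
          exact (measure_mono inter_subset_right).trans (hμ H)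

/-- The set of values of a finite history. -/
noncomputable def hist {b : ℕ} (x : (i : Finset.Iic b) → ℕ) : Finset ℕ := Finset.univ.image x

theorem hist_succ (b : ℕ) (x : ℕ → ℕ) :
    hist (Preorder.frestrictLe (π := fun _ => ℕ) (b+1) x)
      = insert (x (b+1)) (hist (Preorder.frestrictLe (π := fun _ => ℕ) b x)) := by
  ext n
  simp only [hist, Finset.mem_image, Finset.mem_univ, true_and, Finset.mem_insert,
    Preorder.frestrictLe_apply, Subtype.exists, Finset.mem_Iic]
  constructor
  · rintro ⟨i, hi, rfl⟩
    rcases Nat.lt_or_ge b i with hk | hk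
    · left
      congr 1
      omega
    · exact Or.inr ⟨i, hk, rfl⟩
  · rintro (rfl | ⟨i, hi, rfl⟩)
    · exact ⟨b+1, le_rfl, rfl⟩
    · exact ⟨i, by omega, rfl⟩

/-- Random branch through the tree of good positions. -/
theorem exists_random {φ : Set ℕ → ENNReal} (h : IsSubmeasure φ) (hl : IsLscSubmeasure φ)
    (hn : IsNonpathological φ) (htop : φ univ = ⊤) {C : ℕ} (hC : ¬ Bad φ C ∅) :
    ∃ Q : Measure (ℕ → ℕ), IsProbabilityMeasure Q ∧
      (∀ᵐ x ∂Q, φ (range x) ≤ C) ∧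
      ∀ (b : ℕ) (H : Set ℕ), b * Q {x | x (b+1) ∈ H} ≤ φ H := by
  classical
  have hp : ∀ (s : Finset ℕ) (N : ℕ), ∃ p : Measure ℕ, IsProbabilityMeasure p ∧
      (¬ Bad φ C s → p {n | ¬ Bad φ C (insert n s)}ᶜ = 0) ∧ ∀ H, N * p H ≤ φ H := by
    intro s N
    by_cases hs : Bad φ C s
    · obtain ⟨p, h1, _, h3⟩ := exists_prob h hl hn htop N
      exact ⟨p, h1, fun h => absurd hs h, h3⟩
    · obtain ⟨p, h1, h2, h3⟩ := exists_prob h hl hn (good_top hs) N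
      exact ⟨p, h1, fun _ => h2, h3⟩
  choose p hp1 hp2 hp3 using hp
  obtain ⟨a, ha⟩ : ∃ a, ¬ Bad φ C (insert a ∅) := by
    by_contra! hc
    have := good_top hC
    have he : {n | ¬ Bad φ C (insert n ∅)} = ∅ := by
      ext n; simpa using hc n
    rw [he, h.1] at this
    exact absurd this (by simp)
  let κ : (b : ℕ) → Kernel ((i : Finset.Iic b) → (fun _ : ℕ => ℕ) i) ((fun _ : ℕ => ℕ) (b+1)) :=
    fun b => ⟨fun x => p (hist x) b, measurable_of_countable _⟩
  have hκ : ∀ b x, κ b x = p (hist x) b := fun b x => rfl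
  have : ∀ b, IsMarkovKernel (κ b) := fun b => ⟨fun x => hp1 _ _⟩
  let x0 : (i : Finset.Iic 0) → (fun _ : ℕ => ℕ) i := fun _ => a
  let Q : Measure (ℕ → ℕ) := Kernel.traj (X := fun _ : ℕ => ℕ) κ 0 x0
  have hQ : ∀ (b : ℕ) (S : Set (ℕ → ℕ)), MeasurableSet S →
      Q S = ∫⁻ y, Kernel.traj (X := fun _ : ℕ => ℕ) κ b y S ∂(Kernel.partialTraj (X := fun _ : ℕ => ℕ) κ 0 b x0) := by
    intro b S hS
    simp only [Q]
    rw [← Kernel.traj_comp_partialTraj (X := fun _ : ℕ => ℕ) (κ := κ) (Nat.zero_le b), Kernel.comp_apply' _ _ _ hS]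
  have hstep : ∀ (b : ℕ) (y : (i : Finset.Iic b) → ℕ) (H : Set ℕ),
      Kernel.traj (X := fun _ : ℕ => ℕ) κ b y {x | x (b+1) ∈ H} = p (hist y) b H := by
    intro b y H
    rw [← hκ, ← Kernel.map_traj_succ_self (X := fun _ : ℕ => ℕ) (κ := κ), Kernel.map_apply' _ (by fun_prop) _
      MeasurableSet.of_discrete]
    rfl
  have hstay : ∀ (b : ℕ) (y : (i : Finset.Iic b) → ℕ), ∀ᵐ x ∂(Kernel.traj (X := fun _ : ℕ => ℕ) κ b y), Preorder.frestrictLe (π := fun _ => ℕ) b x = y := by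
    intro b y
    have h1 := Kernel.traj_map_frestrictLe_apply (X := fun _ : ℕ => ℕ) (κ := κ) b b y
    rw [Kernel.partialTraj_self, Kernel.id_apply] at h1
    have h2 : ∀ᵐ z ∂((Kernel.traj (X := fun _ : ℕ => ℕ) κ b y).map (Preorder.frestrictLe (π := fun _ => ℕ) b)), z = y := by
      rw [h1]
      exact (ae_dirac_iff (measurableSet_singleton y)).2 rfl
    exact ae_of_ae_map (by fun_prop) h2
  have hgood : ∀ b, ∀ᵐ x ∂Q, ¬ Bad φ C (hist (Preorder.frestrictLe (π := fun _ => ℕ) b x)) := by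
    intro b
    induction b with
    | zero =>
      filter_upwards [hstay 0 x0] with x hx
      rw [hx]
      simpa [hist, x0] using ha
    | succ b ih =>
      have hm : MeasurableSet {x : ℕ → ℕ |
          ¬ Bad φ C (hist (Preorder.frestrictLe (π := fun _ => ℕ) b x)) ∧
          Bad φ C (hist (Preorder.frestrictLe (π := fun _ => ℕ) (b+1) x))} := by
        have m1 : ∀ b, MeasurableSet {x : ℕ → ℕ |
            Bad φ C (hist (Preorder.frestrictLe (π := fun _ => ℕ) b x))} := fun b =>
          (Preorder.measurable_frestrictLe (X := fun _ => ℕ) b)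
            (MeasurableSet.of_discrete (s := {y | Bad φ C (hist y)}))
        exact (m1 b).compl.inter (m1 (b+1))
      have h0 : Q {x : ℕ → ℕ |
          ¬ Bad φ C (hist (Preorder.frestrictLe (π := fun _ => ℕ) b x)) ∧
          Bad φ C (hist (Preorder.frestrictLe (π := fun _ => ℕ) (b+1) x))} = 0 := by
        rw [hQ b _ hm]
        refine lintegral_eq_zero_of_ae_eq_zero (Filter.Eventually.of_forall fun y => ?_)
        simp only [Pi.zero_apply]
        by_cases hy : Bad φ C (hist y)
        · rw [← compl_compl {x : ℕ → ℕ | _}, ← mem_ae_iff]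
          filter_upwards [hstay b y] with x hx hx2
          have hx3 := hx2.1
          rw [hx] at hx3
          exact hx3 hy
        · have h3 := hp2 (hist y) b hy
          rw [← hstep] at h3
          refine measure_mono_null_ae ?_ h3
          filter_upwards [hstay b y] with x hx hx2
          have hx3 := hx2.2
          rw [hist_succ, hx] at hx3
          exact fun hcon => hcon hx3
      have h0' : ∀ᵐ x ∂Q, ¬ (¬ Bad φ C (hist (Preorder.frestrictLe (π := fun _ => ℕ) b x)) ∧
          Bad φ C (hist (Preorder.frestrictLe (π := fun _ => ℕ) (b+1) x))) := by
        rw [ae_iff]; simpa using h0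
      filter_upwards [ih, h0'] with x hx1 hx2 hx3
      exact hx2 ⟨hx1, hx3⟩
  refine ⟨Q, by simp only [Q]; infer_instance, ?_, ?_⟩
  · filter_upwards [ae_all_iff.2 hgood] with x hx
    rw [hl]
    refine iSup_le fun n => ?_
    have hfin : (range x ∩ Iio n).Finite := (finite_Iio n).subset inter_subset_right
    obtain ⟨b, hb⟩ : ∃ b, range x ∩ Iio n ⊆
        (hist (Preorder.frestrictLe (π := fun _ => ℕ) b x) : Set ℕ) := by
      have : ∀ m ∈ range x ∩ Iio n, ∃ k, x k = m := fun m hm => hm.1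
      choose! k hk using this
      obtain ⟨b, hb⟩ := (hfin.image k).bddAbove
      refine ⟨b, fun m hm => ?_⟩
      simp only [hist, Finset.coe_image, Finset.coe_univ, image_univ, mem_range,
        Preorder.frestrictLe_apply, Subtype.exists, Finset.mem_Iic]
      exact ⟨k m, hb (mem_image_of_mem k hm), hk m hm⟩
    exact (mono h hb).trans (good_le (hx b))
  · intro b H
    have hmH : MeasurableSet {x : ℕ → ℕ | x (b+1) ∈ H} :=
      (measurable_pi_apply (b+1)) (MeasurableSet.of_discrete (s := H))
    rw [hQ b _ hmH, ← lintegral_const_mul _ (Kernel.measurable_coe _ hmH)]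
    calc _ ≤ ∫⁻ y, φ H ∂(Kernel.partialTraj (X := fun _ : ℕ => ℕ) κ 0 b x0) := by
          refine lintegral_mono fun y => ?_
          dsimp only
          rw [hstep]
          exact hp3 _ _ _
      _ = φ H := by simp

end EgorovAux

open EgorovAux in
/-- Every tall non-pathological Σ⁰₂ ideal on `ω` is not Egorov. -/
theorem tall_nonpath_sigma2_not_egorov (I : Set (Set ℕ))
    (hI : IsNonpathSigma2 I) (htall : IsTall I) : ¬ IsEgorov I := by
  classical
  obtain ⟨φ, h, hl, hn, htop, rfl⟩ := hI
  obtain ⟨C, hC⟩ := exists_good h htop htall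
  obtain ⟨Q, hQ, hae, hlaw⟩ := exists_random h hl hn htop hC
  obtain ⟨g, hg, hmap⟩ := MeasureTheory.Measure.exists_measurable_map_eq Q
  intro hE
  have hgae : ∀ᵐ u : unitInterval, φ (range (g u)) ≤ C :=
    ae_of_ae_map (hg.aemeasurable) (by rw [hmap]; exact hae)
  let z : ℝ → ℕ → ℕ := fun t => g (projIcc 0 1 zero_le_one t)
  have hzu : ∀ u : unitInterval, z u = g u := fun u => by simp [z, projIcc_val]
  have hz : Measurable z := hg.comp (continuous_projIcc.measurable)
  have hzae : ∀ᵐ t ∂(volume.restrict (Icc (0:ℝ) 1)), φ (range (z t)) ≤ C := by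
    rw [ae_restrict_iff_subtype measurableSet_Icc]
    filter_upwards [hgae] with u hu
    rw [hzu]; exact hu
  let f : ℕ → ℝ → ℝ := fun a t => if a ∈ range (z t) ∧ φ (range (z t)) ≤ C then 1 else 0
  have hmeas : ∀ a, AEMeasurable (f a) (volume.restrict (Icc (0:ℝ) 1)) := by
    intro a
    refine ⟨fun t => if a ∈ range (z t) then 1 else 0, ?_, ?_⟩
    · refine Measurable.ite ?_ measurable_const measurable_const
      have : {t | a ∈ range (z t)} = ⋃ k, {t | z t k = a} := by ext; simp
      rw [this]
      exact MeasurableSet.iUnion fun k =>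
        ((measurable_pi_apply k).comp hz) (measurableSet_singleton a)
    · filter_upwards [hzae] with t ht
      simp [f, ht]
  have hpt : IConvPtwise {A : Set ℕ | φ A < ⊤} f (fun _ => 0) := by
    intro t _ ε hε
    by_cases ht : φ (range (z t)) ≤ C
    · refine lt_of_le_of_lt (mono h ?_) (ht.trans_lt (ENNReal.natCast_lt_top C))
      intro a ha
      by_contra hna
      have h0 : f a t = 0 := if_neg fun hh => hna hh.1
      simp only [mem_ofPred_eq, h0, sub_zero, abs_zero] at ha
      linarith
    · refine lt_of_le_of_lt (mono h (B := ∅) ?_) (by simp [h.1])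
      intro a ha
      simp [f, ht] at ha
      linarith
  obtain ⟨M, hM1, -, hM3, hM4⟩ := hE f (fun _ => 0) hmeas aemeasurable_const hpt (1/2) (by norm_num)
  have hS := hM4 1 one_pos
  set S := {a : ℕ | ∃ t ∈ M, 1 ≤ |f a t - 0|} with hSdef
  have hMvol : (1/2 : ENNReal) ≤ volume M := by
    by_contra hc
    have h1 : volume (Icc (0:ℝ) 1) ≤ volume (Icc (0:ℝ) 1 \ M) + volume M := by
      refine (measure_mono ?_).trans (measure_union_le _ _)
      intro t ht
      by_cases htM : t ∈ M
      · exact Or.inr htM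
      · exact Or.inl ⟨ht, htM⟩
    have h2 : ENNReal.ofReal (1/2) = 1/2 := by
      rw [ENNReal.ofReal_div_of_pos (by norm_num)]; simp
    rw [h2] at hM3
    have h3 := ENNReal.add_lt_add hM3 (not_le.1 hc)
    rw [ENNReal.add_halves] at h3
    rw [Real.volume_Icc] at h1
    simp only [sub_zero, ENNReal.ofReal_one] at h1
    exact absurd (h1.trans_lt h3) (lt_irrefl _)
  have hbound : ∀ b : ℕ, (b : ENNReal) * (1/2) ≤ φ S := by
    intro b
    refine le_trans ?_ (hlaw b S)
    gcongr
    refine hMvol.trans ?_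
    have h1 : volume M = volume ((Subtype.val : unitInterval → ℝ) ⁻¹' M) := by
      rw [show (volume : Measure unitInterval) = Measure.comap Subtype.val volume from rfl,
        (MeasurableEmbedding.subtype_coe measurableSet_Icc).comap_apply,
        image_preimage_eq_of_subset (by rw [Subtype.range_coe]; exact hM1)]
    have hmS : MeasurableSet {x : ℕ → ℕ | x (b+1) ∈ S} :=
      (measurable_pi_apply (b+1)) (MeasurableSet.of_discrete (s := S))
    rw [h1, ← hmap, Measure.map_apply hg hmS]
    refine measure_mono_ae ?_
    filter_upwards [hgae] with u hu huM
    refine ⟨u, huM, ?_⟩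
    have h5 : f (g u (b+1)) u = 1 := by
      simp only [f, hzu]
      rw [if_pos ⟨mem_range_self _, hu⟩]
    rw [h5]; simp
  obtain ⟨N, hN⟩ := ENNReal.exists_nat_gt (ne_of_lt hS)
  have := hbound (2 * N)
  push_cast at this
  rw [mul_comm 2, mul_assoc, ENNReal.mul_div_cancel (by simp) (by simp), mul_one] at this
  exact absurd (hN.trans_le this) (lt_irrefl _)
end

section
/- There exists a family of cardinality 2^{ℵ₀} of pairwise non-isomorphic Borel Egorov ideals on a countable set; explicitly, there is an injection A ↦ J_A from an almost disjoint family of cardinality 2^{ℵ₀} into the Borel Egorov ideals on the countable set ∑_{n∈ω} ω^{n+1} such that J_A and J_B are non-isomorphic whenever A ≠ B. -/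
open MeasureTheory Set

/-- The countable set `∑_{n∈ω} ω^{n+1}`. -/
abbrev SeqSum := Σ n : ℕ, (Fin (n + 1) → ℕ)

/-- The identification of `P(X)` with the Cantor space `2^X`. -/
def idealChar {X : Type} (I : Set (Set X)) : Set (X → Bool) :=
  {x : X → Bool | {a : X | x a = true} ∈ I}

/-- An ideal on a countable set `X` is Borel if it is a Borel subset of `2^X`. -/
def IsBorelIdeal {X : Type} [MeasurableSpace (X → Bool)] (I : Set (Set X)) : Prop :=
  MeasurableSet (idealChar I)


namespace EgorovAux

open Filter

/-- The ideal `Fin^n` on `ω^n`. -/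
def NI : (n : ℕ) → Set (Fin n → ℕ) → Prop
  | 0, S => S = ∅
  | n + 1, S => ∀ᶠ k in atTop, NI n {s | (Fin.cons k s : Fin (n + 1) → ℕ) ∈ S}

theorem NI_succ (n : ℕ) (S : Set (Fin (n + 1) → ℕ)) :
    NI (n + 1) S ↔ ∀ᶠ k in atTop, NI n {s | (Fin.cons k s : Fin (n + 1) → ℕ) ∈ S} := Iff.rfl

theorem NI_mono : ∀ (n : ℕ) (S T : Set (Fin n → ℕ)), S ⊆ T → NI n T → NI n S
  | 0, S, T, h, hT => by
      have hT' : T = ∅ := hT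
      subst hT'
      exact Set.subset_empty_iff.mp h
  | n + 1, S, T, h, hT => by
      rw [NI_succ] at hT ⊢
      filter_upwards [hT] with k hk
      exact NI_mono n _ _ (fun s hs => h hs) hk

theorem NI_empty : ∀ (n : ℕ), NI n ∅
  | 0 => rfl
  | n + 1 => by
      rw [NI_succ]
      exact Eventually.of_forall fun k => NI_empty n

theorem NI_union : ∀ (n : ℕ) (S T : Set (Fin n → ℕ)), NI n S → NI n T → NI n (S ∪ T)
  | 0, S, T, hS, hT => by
      have hS' : S = ∅ := hS
      have hT' : T = ∅ := hT
      subst hS' hT'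
      show (∅ ∪ ∅ : Set _) = ∅
      simp
  | n + 1, S, T, hS, hT => by
      rw [NI_succ] at hS hT ⊢
      filter_upwards [hS, hT] with k hk hk'
      exact NI_union n _ _ hk hk'

theorem NI_biUnion (n : ℕ) {ι : Type} (F : Set ι) (hF : F.Finite) (S : ι → Set (Fin n → ℕ))
    (h : ∀ i ∈ F, NI n (S i)) : NI n (⋃ i ∈ F, S i) := by
  induction F, hF using Set.Finite.induction_on with
  | empty => simpa using NI_empty n
  | insert _ _ ih =>
      rw [Set.biUnion_insert]
      exact NI_union n _ _ (h _ (Set.mem_insert _ _))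
        (ih fun i hi => h i (Set.mem_insert_of_mem _ hi))

/-- each column is null -/
theorem NI_column (n k : ℕ) (S : Set (Fin (n + 1) → ℕ)) (h : ∀ s ∈ S, s 0 = k) :
    NI (n + 1) S := by
  rw [NI_succ]
  filter_upwards [eventually_gt_atTop k] with j hj
  have : {s | (Fin.cons j s : Fin (n + 1) → ℕ) ∈ S} = ∅ := by
    ext s
    simp only [Set.mem_ofPred_eq, Set.mem_empty_iff_false, iff_false]
    intro hs
    have := h _ hs
    simp at this
    omega
  rw [this]
  exact NI_empty n

theorem NI_finite (n : ℕ) (S : Set (Fin (n + 1) → ℕ)) (hS : S.Finite) : NI (n + 1) S := by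
  have : S = ⋃ i ∈ S, {i} := by simp
  rw [this]
  refine NI_biUnion _ _ hS _ fun i _ => NI_column n (i 0) _ ?_
  simp

theorem NI_univ : ∀ n, ¬ NI n Set.univ
  | 0 => by
      intro h
      have h' : (Set.univ : Set (Fin 0 → ℕ)) = ∅ := h
      exact Set.univ_nonempty.ne_empty h'
  | n + 1 => by
      intro h
      rw [NI_succ] at h
      obtain ⟨k, hk⟩ := h.exists
      exact NI_univ n hk

/-- From the case of null fibres to the general one. -/
theorem claim_of (n m : ℕ)
    (hS : ∀ (f : (Fin n → ℕ) → (Fin (m + 1) → ℕ)) (X : Set (Fin n → ℕ)), ¬ NI n X →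
      (∀ k, NI n {s | s ∈ X ∧ f s 0 = k}) →
      ∃ A : Set (Fin (m + 1) → ℕ),
        (∀ k, NI m {u | (Fin.cons k u : Fin (m + 1) → ℕ) ∈ A}) ∧ ¬ NI n {s | s ∈ X ∧ f s ∈ A})
    (f : (Fin n → ℕ) → (Fin (m + 1) → ℕ)) (X : Set (Fin n → ℕ)) (hX : ¬ NI n X) :
    ∃ A : Set (Fin (m + 1) → ℕ), NI (m + 1) A ∧ ¬ NI n {s | s ∈ X ∧ f s ∈ A} := by
  by_cases h : ∀ k, NI n {s | s ∈ X ∧ f s 0 = k}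
  · obtain ⟨A, hA, hA'⟩ := hS f X hX h
    exact ⟨A, Eventually.of_forall hA, hA'⟩
  · push Not at h
    obtain ⟨k, hk⟩ := h
    exact ⟨{u | u 0 = k}, NI_column m k _ (fun s hs => hs), hk⟩

theorem claim_S : ∀ (n m : ℕ), n ≤ m →
    ∀ (f : (Fin n → ℕ) → (Fin (m + 1) → ℕ)) (X : Set (Fin n → ℕ)), ¬ NI n X →
      (∀ k, NI n {s | s ∈ X ∧ f s 0 = k}) →
      ∃ A : Set (Fin (m + 1) → ℕ),
        (∀ k, NI m {u | (Fin.cons k u : Fin (m + 1) → ℕ) ∈ A}) ∧ ¬ NI n {s | s ∈ X ∧ f s ∈ A} := by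
  intro n
  induction n with
  | zero =>
      intro m _ f X hX hk
      exfalso
      have hX' : X ≠ ∅ := hX
      obtain ⟨s, hs⟩ := Set.nonempty_iff_ne_empty.mpr hX'
      have h0 : {s' | s' ∈ X ∧ f s' 0 = f s 0} = ∅ := hk (f s 0)
      have : s ∈ {s' | s' ∈ X ∧ f s' 0 = f s 0} := ⟨hs, rfl⟩
      rw [h0] at this
      exact this
  | succ n ih =>
      intro m hm f X hX hk
      obtain ⟨m', rfl⟩ : ∃ m', m = m' + 1 := ⟨m - 1, by omega⟩
      let Xi : ℕ → Set (Fin n → ℕ) := fun i => {s | (Fin.cons i s : Fin (n + 1) → ℕ) ∈ X}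
      let fi : ℕ → (Fin n → ℕ) → (Fin (m' + 1 + 1) → ℕ) := fun i s => f (Fin.cons i s)
      have key : ∀ i, ∃ A : Set (Fin (m' + 1 + 1) → ℕ), ¬ NI n (Xi i) →
          (∀ k, NI (m' + 1) {u | (Fin.cons k u : Fin (m' + 1 + 1) → ℕ) ∈ A}) ∧
          ¬ NI n {s | s ∈ Xi i ∧ fi i s ∈ A} ∧
          ∀ u ∈ A, i ≤ u 0 ∨ ¬ NI n {s | s ∈ Xi i ∧ fi i s 0 = u 0} := by
        intro i
        by_cases hi : NI n (Xi i)
        · exact ⟨∅, fun h => absurd hi h⟩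
        by_cases hP : ∀ k, NI n {s | s ∈ Xi i ∧ fi i s 0 = k}
        · obtain ⟨A, hA, hA'⟩ := ih (m' + 1) (by omega) (fi i) (Xi i) hi hP
          refine ⟨{u | u ∈ A ∧ i ≤ u 0}, fun _ => ⟨?_, ?_, ?_⟩⟩
          · intro k
            exact NI_mono _ _ _ (fun u hu => hu.1) (hA k)
          · intro hcon
            apply hA'
            have h1 : NI n (⋃ k ∈ Set.Iio i, {s | s ∈ Xi i ∧ fi i s 0 = k}) :=
              NI_biUnion n _ (Set.finite_Iio i) _ fun k _ => hP k
            refine NI_mono _ _ _ ?_ (NI_union n _ _ hcon h1)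
            rintro s ⟨hs, hs'⟩
            by_cases hlt : i ≤ fi i s 0
            · exact Or.inl ⟨hs, hs', hlt⟩
            · refine Or.inr ?_
              simp only [Set.mem_iUnion]
              exact ⟨fi i s 0, not_le.mp hlt, hs, rfl⟩
          · intro u hu
            exact Or.inl hu.2
        · push Not at hP
          obtain ⟨k, hk⟩ := hP
          obtain ⟨B, hB, hB'⟩ := claim_of n m' (ih m' (by omega))
            (fun s => Fin.tail (fi i s)) _ hk
          refine ⟨{u | u 0 = k ∧ Fin.tail u ∈ B}, fun _ => ⟨?_, ?_, ?_⟩⟩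
          · intro j
            refine NI_mono _ _ _ ?_ hB
            rintro u ⟨_, hu⟩
            simpa using hu
          · intro hcon
            apply hB'
            refine NI_mono _ _ _ ?_ hcon
            rintro s ⟨⟨h1, h2⟩, h3⟩
            exact ⟨h1, h2, h3⟩
          · rintro u ⟨hu, _⟩
            right
            rw [hu]
            exact hk
      choose A hA using key
      refine ⟨{u | ∃ i, ¬ NI n (Xi i) ∧ u ∈ A i}, ?_, ?_⟩
      · intro k
        have hfin : {i | i ≤ k ∨ ¬ NI n {s | s ∈ Xi i ∧ fi i s 0 = k}}.Finite := by
          apply Set.Finite.union (Set.finite_Iic k)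
          have := hk k
          rw [NI_succ, eventually_atTop] at this
          obtain ⟨a, ha⟩ := this
          refine (Set.finite_Iio a).subset ?_
          intro i hi
          by_contra hcon
          exact hi (ha i (not_lt.mp hcon))
        have := NI_biUnion (m' + 1) _ (hfin.subset (t := {i | (i ≤ k ∨
            ¬ NI n {s | s ∈ Xi i ∧ fi i s 0 = k}) ∧ ¬ NI n (Xi i)}) (fun i hi => hi.1))
          (fun i => {u | (Fin.cons k u : Fin (m' + 1 + 1) → ℕ) ∈ A i})
          (fun i hi => (hA i hi.2).1 k)
        refine NI_mono _ _ _ ?_ this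
        rintro u ⟨i, hi, hu⟩
        simp only [Set.mem_iUnion]
        refine ⟨i, ⟨?_, hi⟩, hu⟩
        have := (hA i hi).2.2 _ hu
        simpa using this
      · intro hcon
        apply hX
        rw [NI_succ] at hcon ⊢
        filter_upwards [hcon] with i hi
        by_contra hni
        apply (hA i hni).2.1
        refine NI_mono _ _ _ ?_ hi
        rintro s ⟨h1, h2⟩
        exact ⟨h1, i, hni, h2⟩

theorem claim (n m : ℕ) (h : n ≤ m)
    (f : (Fin n → ℕ) → (Fin (m + 1) → ℕ)) (X : Set (Fin n → ℕ)) (hX : ¬ NI n X) :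
    ∃ A : Set (Fin (m + 1) → ℕ), NI (m + 1) A ∧ ¬ NI n {s | s ∈ X ∧ f s ∈ A} :=
  claim_of n m (claim_S n m h) f X hX

/-- Measurability of `Fin^n`. -/
theorem NI_measurable {Ω : Type} [MeasurableSpace Ω] : ∀ (n : ℕ) (E : (Fin n → ℕ) → Set Ω),
    (∀ s, MeasurableSet (E s)) → MeasurableSet {x | NI n {s | x ∈ E s}}
  | 0, E, hE => by
      have : {x | NI 0 {s | x ∈ E s}} = ⋂ s, (E s)ᶜ := by
        ext x
        simp only [Set.mem_ofPred_eq, Set.mem_iInter, Set.mem_compl_iff]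
        exact Set.eq_empty_iff_forall_notMem
      rw [this]
      exact MeasurableSet.iInter fun s => (hE s).compl
  | n + 1, E, hE => by
      have : {x | NI (n + 1) {s | x ∈ E s}} =
          ⋃ a : ℕ, ⋂ k : ℕ, ⋂ _ : a ≤ k, {x | NI n {s | x ∈ E (Fin.cons k s)}} := by
        ext x
        simp only [Set.mem_ofPred_eq, Set.mem_iUnion, Set.mem_iInter]
        rw [NI_succ, eventually_atTop]
        rfl
      rw [this]
      exact MeasurableSet.iUnion fun a => MeasurableSet.iInter fun k => MeasurableSet.iInter fun _ =>
        NI_measurable n _ fun s => hE _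

open scoped ENNReal

/-- Egorov for `Fin^n`, in terms of sets. -/
theorem NI_egorov {Ω : Type} [MeasurableSpace Ω] (μ : Measure Ω) :
    ∀ (n : ℕ) (E : (Fin n → ℕ) → Set Ω), (∀ s, MeasurableSet (E s)) →
    ∀ D : Set Ω, MeasurableSet D → μ D ≠ ⊤ → (∀ x ∈ D, NI n {s | x ∈ E s}) →
    ∀ δ : ℝ≥0∞, δ ≠ 0 → ∃ M ⊆ D, MeasurableSet M ∧ μ (D \ M) ≤ δ ∧
      NI n {s | (M ∩ E s).Nonempty}
  | 0, E, hE, D, hD, hfin, hx, δ, hδ => by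
      refine ⟨D, subset_rfl, hD, by simp, ?_⟩
      show _ = ∅
      rw [Set.eq_empty_iff_forall_notMem]
      rintro s ⟨x, hxD, hxE⟩
      have h : {s | x ∈ E s} = ∅ := hx x hxD
      have : s ∈ {s | x ∈ E s} := hxE
      rw [h] at this
      exact this
  | n + 1, E, hE, D, hD, hfin, hx, δ, hδ => by
      let Dk : ℕ → Set Ω := fun a => D ∩ ⋂ k : ℕ, ⋂ _ : a ≤ k, {x | NI n {s | x ∈ E (Fin.cons k s)}}
      have hDk : ∀ a, MeasurableSet (Dk a) := fun a => hD.inter <|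
        MeasurableSet.iInter fun k => MeasurableSet.iInter fun _ => NI_measurable n _ fun s => hE _
      have hanti : Antitone fun a => D \ Dk a := by
        intro a b hab x hx
        refine ⟨hx.1, fun h => hx.2 ⟨hx.1, ?_⟩⟩
        have h2 := h.2
        simp only [Set.mem_iInter] at h2 ⊢
        intro k hk
        exact h2 k (hab.trans hk)
      have hempty : ⋂ a, D \ Dk a = ∅ := by
        rw [Set.eq_empty_iff_forall_notMem]
        intro x hxx
        rw [Set.mem_iInter] at hxx
        have h1 := hx x (hxx 0).1
        rw [NI_succ, eventually_atTop] at h1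
        obtain ⟨a, ha⟩ := h1
        refine (hxx a).2 ⟨(hxx a).1, ?_⟩
        simp only [Set.mem_iInter]
        exact ha
      have hlim : Tendsto (fun a => μ (D \ Dk a)) atTop (nhds 0) := by
        have := tendsto_measure_iInter_atTop (μ := μ) (s := fun a => D \ Dk a)
          (fun a => (hD.diff (hDk a)).nullMeasurableSet) hanti
          ⟨0, ((measure_mono Set.sdiff_subset).trans_lt hfin.lt_top).ne⟩
        rwa [hempty, measure_empty] at this
      have hδ2 : δ / 2 ≠ 0 := (ENNReal.half_pos hδ).ne'
      obtain ⟨a, ha⟩ := (hlim.eventually (ge_mem_nhds (pos_iff_ne_zero.mpr hδ2))).exists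
      obtain ⟨ε, hε, hsum⟩ := ENNReal.exists_pos_sum_of_countable hδ2 ℕ
      have ih : ∀ k, ∃ M, a ≤ k → M ⊆ Dk a ∧ MeasurableSet M ∧ μ (Dk a \ M) ≤ ε k ∧
          NI n {s | (M ∩ E (Fin.cons k s)).Nonempty} := by
        intro k
        by_cases hk : a ≤ k
        · obtain ⟨M, h⟩ := NI_egorov μ n (fun s => E (Fin.cons k s)) (fun s => hE _) (Dk a) (hDk a)
            ((measure_mono Set.inter_subset_left).trans_lt hfin.lt_top).ne
            (by
              intro x hx
              have := hx.2
              simp only [Set.mem_iInter] at this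
              exact this k hk) (ε k) (by simpa using (hε k).ne')
          exact ⟨M, fun _ => h⟩
        · exact ⟨∅, fun h => absurd h hk⟩
      choose M hM using ih
      refine ⟨Dk a ∩ ⋂ k, ⋂ _ : a ≤ k, M k, ?_, ?_, ?_, ?_⟩
      · exact Set.inter_subset_left.trans Set.inter_subset_left
      · exact (hDk a).inter (MeasurableSet.iInter fun k => MeasurableSet.iInter fun hk => (hM k hk).2.1)
      · have hsub : D \ (Dk a ∩ ⋂ k, ⋂ _ : a ≤ k, M k) ⊆
            (D \ Dk a) ∪ ⋃ k, ⋃ _ : a ≤ k, (Dk a \ M k) := by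
          rintro x ⟨hxD, hx⟩
          by_cases h : x ∈ Dk a
          · right
            by_contra hcon
            apply hx
            refine ⟨h, ?_⟩
            simp only [Set.mem_iUnion, not_exists] at hcon
            simp only [Set.mem_iInter]
            intro k hk
            by_contra h'
            exact hcon k hk ⟨h, h'⟩
          · exact Or.inl ⟨hxD, h⟩
        calc _ ≤ μ (D \ Dk a) + μ (⋃ k, ⋃ _ : a ≤ k, (Dk a \ M k)) :=
              (measure_mono hsub).trans (measure_union_le _ _)
          _ ≤ δ / 2 + ∑' k, (ε k : ℝ≥0∞) := by
              refine add_le_add ha ((measure_iUnion_le _).trans (ENNReal.tsum_le_tsum fun k => ?_))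
              by_cases hk : a ≤ k
              · simpa [hk] using (hM k hk).2.2.1
              · simp [hk]
          _ ≤ δ / 2 + δ / 2 := by gcongr
          _ = δ := ENNReal.add_halves δ
      · rw [NI_succ]
        filter_upwards [eventually_ge_atTop a] with k hk
        refine NI_mono _ _ _ ?_ (hM k hk).2.2.2
        rintro s ⟨x, hx1, hx2⟩
        refine ⟨x, ?_, hx2⟩
        have := hx1.2
        simp only [Set.mem_iInter] at this
        exact this k hk

/-- The ideal `J_A`. -/
def JA (A : Set ℕ) : Set (Set SeqSum) :=
  {S | ∀ n ∈ A, NI (n + 1) {s | (⟨n, s⟩ : SeqSum) ∈ S}}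

theorem JA_mono (A : Set ℕ) (S T : Set SeqSum) (h : S ⊆ T) (hT : T ∈ JA A) : S ∈ JA A :=
  fun n hn => NI_mono _ _ _ (fun _ hs => h hs) (hT n hn)

theorem JA_ideal (A : Set ℕ) (hA : A.Nonempty) : IsIdeal (JA A) := by
  refine ⟨fun S T hS hT n hn => NI_union _ _ _ (hS n hn) (hT n hn), JA_mono A, ?_, ?_⟩
  · intro S hS n hn
    apply NI_finite
    refine hS.preimage (f := fun s => (⟨n, s⟩ : SeqSum)) ?_
    intro a _ b _ hab
    simpa using hab
  · intro h
    obtain ⟨n, hn⟩ := hA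
    exact NI_univ _ (h n hn)

theorem JA_borel (A : Set ℕ) : IsBorelIdeal (JA A) := by
  have : idealChar (JA A) = ⋂ n : ℕ, ⋂ _ : n ∈ A,
      {x : SeqSum → Bool | NI (n + 1) {s | x ∈ {y : SeqSum → Bool | y ⟨n, s⟩ = true}}} := by
    ext x
    simp only [Set.mem_iInter]
    rfl
  unfold IsBorelIdeal
  rw [this]
  refine MeasurableSet.iInter fun n => MeasurableSet.iInter fun _ => NI_measurable _ _ fun s => ?_
  have h := measurable_pi_apply (X := fun _ : SeqSum => Bool) (⟨n, s⟩ : SeqSum)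
  exact h (measurableSet_singleton true)

theorem JA_egorov (A : Set ℕ) : IsEgorov (JA A) := by
  intro f g hf hg hconv η hη
  -- the exceptional null set
  have hae : ∀ᵐ t ∂(volume.restrict (Icc (0:ℝ) 1)),
      (∀ a, f a t = (hf a).mk (f a) t) ∧ g t = hg.mk g t := by
    rw [eventually_and, ae_all_iff]
    exact ⟨fun a => (hf a).ae_eq_mk, hg.ae_eq_mk⟩
  obtain ⟨Z, hZsub, hZm, hZ0⟩ := exists_measurable_superset_of_null (ae_iff.mp hae)
  let D : Set ℝ := Icc (0:ℝ) 1 \ Z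
  have hD : MeasurableSet D := measurableSet_Icc.diff hZm
  have hDZ : volume (Icc (0:ℝ) 1 \ D) = 0 := by
    rw [Measure.restrict_apply hZm] at hZ0
    refine measure_mono_null ?_ hZ0
    intro t ht
    refine ⟨?_, ht.1⟩
    by_contra h
    exact ht.2 ⟨ht.1, h⟩
  have hDfin : volume D ≠ ⊤ :=
    ((measure_mono Set.sdiff_subset).trans_lt (by simp : volume (Icc (0:ℝ) 1) < ⊤)).ne
  have hDeq : ∀ t ∈ D, (∀ a, f a t = (hf a).mk (f a) t) ∧ g t = hg.mk g t := by
    intro t ht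
    by_contra h
    exact ht.2 (hZsub h)
  have hη2 : ENNReal.ofReal η / 2 ≠ 0 := (ENNReal.half_pos (by simpa using hη)).ne'
  obtain ⟨ε, hε, hsum⟩ := ENNReal.exists_pos_sum_of_countable hη2 (ℕ × ℕ)
  have key : ∀ p : ℕ × ℕ, ∃ M : Set ℝ, p.1 ∈ A → M ⊆ D ∧ MeasurableSet M ∧
      volume (D \ M) ≤ ε p ∧
      NI (p.1 + 1) {s | (M ∩ {t | 1 / ((p.2 : ℝ) + 1) ≤
        |(hf ⟨p.1, s⟩).mk (f ⟨p.1, s⟩) t - hg.mk g t|}).Nonempty} := by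
    rintro ⟨n, j⟩
    by_cases hn : n ∈ A
    · obtain ⟨M, h⟩ := NI_egorov volume (n + 1) (fun s => {t | 1 / ((j : ℝ) + 1) ≤
        |(hf ⟨n, s⟩).mk (f ⟨n, s⟩) t - hg.mk g t|})
        (fun s => measurableSet_le measurable_const
          (((hf ⟨n, s⟩).measurable_mk.sub hg.measurable_mk).abs)) D hD hDfin
        (by
          intro t ht
          have := hconv t ht.1 (1 / ((j : ℝ) + 1)) (by positivity) n hn
          refine NI_mono _ _ _ ?_ this
          intro s hs
          simp only [Set.mem_ofPred_eq] at hs ⊢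
          rw [(hDeq t ht).1, (hDeq t ht).2]
          exact hs) (ε (n, j)) (by simpa using (hε (n, j)).ne')
      exact ⟨M, fun _ => h⟩
    · exact ⟨∅, fun h => absurd h hn⟩
  choose M hM using key
  have hMm : MeasurableSet (D ∩ ⋂ p : ℕ × ℕ, ⋂ _ : p.1 ∈ A, M p) :=
    hD.inter (MeasurableSet.iInter fun p => MeasurableSet.iInter fun hp => (hM p hp).2.1)
  have hnull : NullMeasurableSet (D ∩ ⋂ p : ℕ × ℕ, ⋂ _ : p.1 ∈ A, M p) (volume : Measure ℝ) :=
    MeasurableSet.nullMeasurableSet hMm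
  refine ⟨D ∩ ⋂ p : ℕ × ℕ, ⋂ _ : p.1 ∈ A, M p, Set.inter_subset_left.trans Set.sdiff_subset,
    hnull, ?_, ?_⟩
  · have hsub : Icc (0:ℝ) 1 \ (D ∩ ⋂ p : ℕ × ℕ, ⋂ _ : p.1 ∈ A, M p) ⊆
        (Icc (0:ℝ) 1 \ D) ∪ ⋃ p : ℕ × ℕ, ⋃ _ : p.1 ∈ A, (D \ M p) := by
      rintro x ⟨hxD, hx⟩
      by_cases h : x ∈ D
      · right
        by_contra hcon
        apply hx
        refine ⟨h, ?_⟩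
        simp only [Set.mem_iUnion, not_exists] at hcon
        simp only [Set.mem_iInter]
        intro k hk
        by_contra h'
        exact hcon k hk ⟨h, h'⟩
      · exact Or.inl ⟨hxD, h⟩
    calc _ ≤ volume (Icc (0:ℝ) 1 \ D) + volume (⋃ p : ℕ × ℕ, ⋃ _ : p.1 ∈ A, (D \ M p)) :=
          (measure_mono hsub).trans (measure_union_le _ _)
      _ ≤ 0 + ∑' p, (ε p : ℝ≥0∞) := by
          refine add_le_add hDZ.le ((measure_iUnion_le _).trans (ENNReal.tsum_le_tsum fun p => ?_))
          by_cases hk : p.1 ∈ A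
          · simpa [hk] using (hM p hk).2.2.1
          · simp [hk]
      _ < ENNReal.ofReal η / 2 := by rw [zero_add]; exact hsum
      _ ≤ ENNReal.ofReal η := ENNReal.half_le_self
  · intro e he n hn
    obtain ⟨j, hj⟩ := exists_nat_one_div_lt he
    have hlast := (hM (n, j) hn).2.2.2
    dsimp only at hlast
    apply NI_mono (n + 1) _ _ _ hlast
    rintro s ⟨t, ht, hte⟩
    refine ⟨t, ?_, ?_⟩
    · have := ht.2
      simp only [Set.mem_iInter] at this
      exact this (n, j) hn
    · simp only [Set.mem_ofPred_eq]
      rw [← (hDeq t ht.1).1, ← (hDeq t ht.1).2]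
      exact hj.le.trans hte

/-- The `n`-th block. -/
def Yb (n : ℕ) : Set SeqSum := {a | a.1 = n}

theorem blocks (A B : Set ℕ) (f : SeqSum → SeqSum) (hf : ∀ S ∈ JA A, f ⁻¹' S ∈ JA B)
    (p q : ℕ) (hq : q ∈ B) (hpq : q < p) : f ⁻¹' (Yb p) ∩ Yb q ∈ JA B := by
  intro n hn
  by_cases hnq : n = q
  swap
  · refine NI_mono _ _ _ ?_ (NI_empty _)
    rintro s ⟨_, hs⟩
    exact hnq hs
  subst hnq
  by_contra hX
  let h : (Fin (n + 1) → ℕ) → (Fin (p + 1) → ℕ) := fun s =>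
    if hs : (f ⟨n, s⟩).1 = p then hs ▸ (f ⟨n, s⟩).2 else fun _ => 0
  have hh : ∀ s, (f ⟨n, s⟩).1 = p → f ⟨n, s⟩ = ⟨p, h s⟩ := by
    intro s hs
    have : h s = hs ▸ (f ⟨n, s⟩).2 := dif_pos hs
    rw [this]
    generalize f ⟨n, s⟩ = a at hs
    obtain ⟨a1, a2⟩ := a
    dsimp only at hs
    subst hs
    rfl
  obtain ⟨C, hC, hC'⟩ := claim (n + 1) p hpq h _ hX
  apply hC'
  let S : Set SeqSum := {a | ∃ u ∈ C, a = ⟨p, u⟩}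
  have hS : S ∈ JA A := by
    intro m hm
    by_cases hmp : m = p
    · subst hmp
      refine NI_mono _ _ _ ?_ hC
      rintro s ⟨u, hu, hsu⟩
      have := sigma_mk_injective hsu
      rw [this]
      exact hu
    · refine NI_mono _ _ _ ?_ (NI_empty _)
      rintro s ⟨u, hu, hsu⟩
      exact hmp (congrArg Sigma.fst hsu)
  refine NI_mono _ _ _ ?_ (hf S hS n hn)
  rintro s ⟨⟨hs1, _⟩, hs2⟩
  exact ⟨h s, hs2, hh s hs1⟩

theorem iso_subset (A B : Set ℕ) (f g : SeqSum → SeqSum)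
    (hfg : Function.LeftInverse f g) (hgf : Function.LeftInverse g f)
    (hf : ∀ S ∈ JA A, f ⁻¹' S ∈ JA B) (hg : ∀ S ∈ JA B, g ⁻¹' S ∈ JA A) : B ⊆ A := by
  intro m hm
  by_contra hmA
  have hgf' : ∀ S : Set SeqSum, f ⁻¹' (g ⁻¹' S) = S := by
    intro S; ext x; simp [hgf x]
  have hfg' : ∀ S : Set SeqSum, g ⁻¹' (f ⁻¹' S) = S := by
    intro S; ext x; simp [hfg x]
  have hbl : ∀ n ∈ A, f ⁻¹' (Yb n) ∩ Yb m ∈ JA B := by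
    intro n hn
    rcases lt_trichotomy n m with h | h | h
    · have h1 := hf _ (blocks B A g hg m n hn h)
      rw [Set.preimage_inter, hgf'] at h1
      rwa [Set.inter_comm]
    · exact absurd (h ▸ hn) hmA
    · exact blocks A B f hf n m hm h
  have h2 : g ⁻¹' (Yb m) ∈ JA A := by
    intro n hn
    have h1 := hg _ (hbl n hn)
    rw [Set.preimage_inter, hfg'] at h1
    refine NI_mono _ _ _ ?_ (h1 n hn)
    intro s hs
    exact ⟨rfl, hs⟩
  have h3 := hf _ h2
  rw [hgf'] at h3
  refine NI_univ _ (NI_mono _ _ _ ?_ (h3 m hm))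
  intro s _
  rfl

theorem not_iso (A B : Set ℕ) (h : IdealIso (JA A) (JA B)) : A = B := by
  obtain ⟨f, hbij, hf⟩ := h
  let e := Equiv.ofBijective f hbij
  have hfg : Function.LeftInverse f e.symm := fun x => e.apply_symm_apply x
  have hgf : Function.LeftInverse e.symm f := fun x => e.symm_apply_apply x
  have h1 : ∀ S ∈ JA A, f ⁻¹' S ∈ JA B := fun S hS => (hf S).mp hS
  have h2 : ∀ S ∈ JA B, e.symm ⁻¹' S ∈ JA A := by
    intro S hS
    rw [hf]
    have : f ⁻¹' (e.symm ⁻¹' S) = S := by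
      ext x; simp [hgf x]
    rwa [this]
  exact Set.Subset.antisymm (iso_subset B A e.symm f hgf hfg h2 h1)
    (iso_subset A B f e.symm hfg hgf h1 h2)

/-- A branch of the binary tree, as a set of naturals. -/
def code (x : ℕ → Bool) (n : ℕ) : ℕ := Encodable.encode (List.ofFn fun i : Fin n => x i)

theorem code_inj {x y : ℕ → Bool} {n m : ℕ} (h : code x n = code y m) :
    n = m ∧ ∀ i < n, x i = y i := by
  have h1 := Encodable.encode_injective h
  have hl := congrArg List.length h1
  simp only [List.length_ofFn] at hl
  subst hl
  refine ⟨rfl, fun i hi => ?_⟩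
  have := List.ofFn_injective h1
  exact congrFun this ⟨i, hi⟩

def br (x : ℕ → Bool) : Set ℕ := Set.range (code x)

theorem br_infinite (x : ℕ → Bool) : (br x).Infinite :=
  Set.infinite_range_of_injective fun _ _ h => (code_inj h).1

theorem br_ad {x y : ℕ → Bool} (h : x ≠ y) : (br x ∩ br y).Finite := by
  obtain ⟨i, hi⟩ := Function.ne_iff.mp h
  refine ((Set.finite_Iic i).image (code x)).subset ?_
  rintro _ ⟨⟨n, rfl⟩, ⟨m, hm⟩⟩
  refine ⟨n, ?_, rfl⟩
  by_contra hn
  exact hi ((code_inj hm.symm).2 i (not_le.mp hn))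

theorem br_injective : Function.Injective br := by
  intro x y h
  by_contra hne
  have := br_ad hne
  rw [h, Set.inter_self] at this
  exact br_infinite y this

end EgorovAux

/-- There are `2^ℵ₀` pairwise non-isomorphic Borel Egorov ideals: there is a map
`A ↦ J_A` from an almost disjoint family of cardinality `2^ℵ₀` to Borel Egorov ideals
on the countable set `∑_{n∈ω} ω^{n+1}`, with `J_A` and `J_B` non-isomorphic for `A ≠ B`. -/
theorem exists_continuum_nonisomorphic_borel_egorov :
    ∃ (𝒜 : Set (Set ℕ)) (J : Set ℕ → Set (Set SeqSum)),
      (∀ A ∈ 𝒜, A.Infinite) ∧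
      (∀ A ∈ 𝒜, ∀ B ∈ 𝒜, A ≠ B → (A ∩ B).Finite) ∧
      Cardinal.mk ↥𝒜 = Cardinal.continuum ∧
      (∀ A ∈ 𝒜, IsIdeal (J A) ∧ IsBorelIdeal (J A) ∧ IsEgorov (J A)) ∧
      (∀ A ∈ 𝒜, ∀ B ∈ 𝒜, A ≠ B → ¬ IdealIso (J A) (J B)) := by
  refine ⟨Set.range EgorovAux.br, EgorovAux.JA, ?_, ?_, ?_, ?_, ?_⟩
  · rintro _ ⟨x, rfl⟩
    exact EgorovAux.br_infinite x
  · rintro _ ⟨x, rfl⟩ _ ⟨y, rfl⟩ h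
    exact EgorovAux.br_ad fun hxy => h (hxy ▸ rfl)
  · rw [Cardinal.mk_range_eq _ EgorovAux.br_injective]
    simp
  · rintro _ ⟨x, rfl⟩
    exact ⟨EgorovAux.JA_ideal _ (EgorovAux.br_infinite x).nonempty, EgorovAux.JA_borel _,
      EgorovAux.JA_egorov _⟩
  · intro A _ B _ h hiso
    exact h (EgorovAux.not_iso A B hiso)
end
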